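/- Under conditions (B1)–(B4), for every 0 < c < d < ∞, k^{−1/2} sup_{x ∈ [c,d]} Σ_{i=1}^n | 1{Z_i > x b*(n/k)} − 1{Ẑ_i > x b*(n/k)} | converges to 0 in probability as n → ∞. -/

import Mathlib

open MeasureTheory ProbabilityTheory Filter Set
open scoped ProbabilityTheory

noncomputable section

namespace TailCusum

variable {Ω : Type*} [MeasureSpace Ω]

/-- `φ₁(x) = 1{x > 0}`. -/
def phi1 (x : ℝ) : ℝ := if 0 < x then 1 else 0

/-- `φ₂(x) = x₊ = max {x, 0}`. -/
def phi2 (x : ℝ) : ℝ := max x 0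

/-- positive part -/
def pos (x : ℝ) : ℝ := max x 0

/-- A positive measurable function `g` is regularly varying at `∞` with index `ρ` if
`g(λ x)/g(x) → λ^ρ` as `x → ∞` for every `λ > 0`. -/
def RegularlyVarying (g : ℝ → ℝ) (ρ : ℝ) : Prop :=
  Measurable g ∧ ∀ lam : ℝ, 0 < lam →
    Tendsto (fun x => g (lam * x) / g x) atTop (nhds (lam ^ ρ))

/-- `l` is slowly varying at `∞`. -/
def SlowlyVarying (l : ℝ → ℝ) : Prop :=
  Measurable l ∧ ∀ lam : ℝ, 0 < lam →
    Tendsto (fun x => l (lam * x) / l x) atTop (nhds 1)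

/-- `κ(λ) = K ∫_1^λ t^(γ-1) dt`. -/
def kappaFun (K γ : ℝ) (lam : ℝ) : ℝ := K * ∫ t in (1:ℝ)..lam, t ^ (γ - 1)

/-- Second-order regular variation condition on the slowly varying function `l`
(the core of condition (A2)): `(l(λx)/l(x) - 1)/g(x) → κ(λ)` with
`κ(λ) = K ∫_1^λ t^(γ-1) dt`, `g` positive and regularly varying with index `γ ≤ 0`. -/
def SecondOrderRV (l g : ℝ → ℝ) (K γ : ℝ) : Prop :=
  γ ≤ 0 ∧ (∀ x, 0 < g x) ∧ RegularlyVarying g γ ∧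
  ∀ lam : ℝ, 0 < lam →
    Tendsto (fun x => (l (lam * x) / l x - 1) / g x) atTop (nhds (kappaFun K γ lam))

/-- distribution function of a law on `ℝ` -/
def df (μ : Measure ℝ) (x : ℝ) : ℝ := (μ (Iic x)).toReal

/-- tail distribution function `F̄(x) = μ(x, ∞)` -/
def tailDF (μ : Measure ℝ) (x : ℝ) : ℝ := (μ (Ioi x)).toReal

/-- the quantile-type function `b(x) = inf {y : F(y) ≥ 1 - x⁻¹}` -/
def quantileB (μ : Measure ℝ) (x : ℝ) : ℝ := sInf {y : ℝ | 1 - x⁻¹ ≤ df μ y}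

/-- `F̄(x) = x^(-α) l(x)` for `x > 0` with `l` slowly varying: Pareto-type tail. -/
def ParetoTail (μ : Measure ℝ) (α : ℝ) (l : ℝ → ℝ) : Prop :=
  SlowlyVarying l ∧ ∀ x : ℝ, 0 < x → tailDF μ x = x ^ (-α) * l x

/-- strict stationarity of a sequence of random variables -/
def IsStationary (X : ℕ → Ω → ℝ) : Prop :=
  ∀ j : ℕ,
    Measure.map (fun ω => fun i : ℕ => X (i + j) ω) (ℙ : Measure Ω)
      = Measure.map (fun ω => fun i : ℕ => X i ω) (ℙ : Measure Ω)

/-- strict stationarity, `ℤ`-indexed -/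
def IsStationaryZ (X : ℤ → Ω → ℝ) : Prop :=
  ∀ j : ℤ,
    Measure.map (fun ω => fun i : ℤ => X (i + j) ω) (ℙ : Measure Ω)
      = Measure.map (fun ω => fun i : ℤ => X i ω) (ℙ : Measure Ω)

/-- The β-mixing coefficient of the sequence `X` at lag `lag`, expressed as
the supremum over `m` of the total-variation distance between the joint law of
`(X_1, …, X_m)` and `(X_{m+lag+1}, X_{m+lag+2}, …)` and the product of the two laws. -/
def betaMix (X : ℕ → Ω → ℝ) (lag : ℕ) : ℝ :=
  ⨆ m : ℕ, ⨆ S : Subtype (MeasurableSet : Set ((Fin m → ℝ) × (ℕ → ℝ)) → Prop),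
    |((Measure.map
        (fun ω => ((fun i : Fin m => X ((i : ℕ) + 1) ω, fun i : ℕ => X (m + lag + 1 + i) ω)))
        (ℙ : Measure Ω)) S.1).toReal
      - (((Measure.map (fun ω => fun i : Fin m => X ((i : ℕ) + 1) ω) (ℙ : Measure Ω)).prod
          (Measure.map (fun ω => fun i : ℕ => X (m + lag + 1 + i) ω) (ℙ : Measure Ω))) S.1).toReal|

/-- The tail sample fraction condition: `k → ∞` and `k = o(n)`. -/
def TailFraction (k : ℕ → ℕ) : Prop :=
  Tendsto (fun n : ℕ => (k n : ℝ)) atTop atTop ∧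
    Tendsto (fun n : ℕ => (k n : ℝ) / n) atTop (nhds 0)

/-- Condition (A1): `(n / r_n) β([ε r_n]) → 0` for every `ε > 0`, and `r_n² = o(k)`. -/
def CondA1 (X : ℕ → Ω → ℝ) (k r : ℕ → ℕ) : Prop :=
  (∀ n, 0 < r n) ∧
  (∀ ε : ℝ, 0 < ε →
    Tendsto (fun n : ℕ => ((n : ℝ) / r n) * betaMix X ⌊ε * r n⌋₊) atTop (nhds 0)) ∧
  Tendsto (fun n : ℕ => ((r n : ℝ) ^ 2 / k n)) atTop (nhds 0)

/-- Condition (A2): second-order regular variation of `l` plus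
`√k · g(b(n/k)) → A ∈ ℝ`. -/
def CondA2 (l g : ℝ → ℝ) (K γ A : ℝ) (b : ℝ → ℝ) (k : ℕ → ℕ) : Prop :=
  SecondOrderRV l g K γ ∧
    Tendsto (fun n : ℕ => Real.sqrt (k n) * g (b ((n : ℝ) / k n))) atTop (nhds A)

/-- covariance of two real random variables -/
def cov (f g : Ω → ℝ) : ℝ :=
  ∫ ω, (f ω - ∫ ω', f ω') * (g ω - ∫ ω', g ω')

/-- pairs `1 ≤ i < j ≤ N` -/
def pairsUpTo (N : ℕ) : Finset (ℕ × ℕ) :=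
  ((Finset.Icc 1 N) ×ˢ (Finset.Icc 1 N)).filter fun p => p.1 < p.2

/-- Condition (A3): existence of the limits `χ` and `ω` of the normalized sums of
covariances, for every `0 < ε < 1`. -/
def CondA3 (X : ℕ → Ω → ℝ) (b : ℝ → ℝ) (k r : ℕ → ℕ) (α χ ωc : ℝ) : Prop :=
  0 ≤ χ ∧ 0 ≤ ωc ∧
  ∀ ε : ℝ, 0 < ε → ε < 1 →
    (Tendsto (fun n : ℕ =>
        (2 * α ^ 2 * n / ((⌊ε * r n⌋₊ : ℝ) * k n)) *
          ∑ p ∈ pairsUpTo ⌊ε * r n⌋₊,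
            cov (fun ω => pos (Real.log (X p.1 ω) - Real.log (b ((n : ℝ) / k n))))
                (fun ω => pos (Real.log (X p.2 ω) - Real.log (b ((n : ℝ) / k n)))))
      atTop (nhds χ)) ∧
    (Tendsto (fun n : ℕ =>
        (2 * (n : ℝ) / ((⌊ε * r n⌋₊ : ℝ) * k n)) *
          ∑ p ∈ pairsUpTo ⌊ε * r n⌋₊,
            cov (fun ω => if b ((n : ℝ) / k n) < X p.1 ω then (1 : ℝ) else 0)
                (fun ω => if b ((n : ℝ) / k n) < X p.2 ω then (1 : ℝ) else 0))
      atTop (nhds ωc))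

/-- the `k`-th largest value among `X_1, …, X_n` -/
def orderStat (n k : ℕ) (X : ℕ → Ω → ℝ) (ω : Ω) : ℝ :=
  sInf {x : ℝ | ((Finset.Icc 1 n).filter fun i => x < X i ω).card < k}

/-- `|Σ_{i=1}^l Y_i - (l/n) Σ_{i=1}^n Y_i|` -/
def cusumAt (n : ℕ) (Y : ℕ → ℝ) (l : ℕ) : ℝ :=
  |∑ i ∈ Finset.Icc 1 l, Y i - ((l : ℝ) / n) * ∑ i ∈ Finset.Icc 1 n, Y i|

/-- The cusum statistic `T_n(φ)` with random threshold `X_(k)`. -/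
def cusum (n k : ℕ) (X : ℕ → Ω → ℝ) (φ : ℝ → ℝ) (ω : Ω) : ℝ :=
  (Real.sqrt k)⁻¹ *
    ⨆ l ∈ Finset.Icc 1 n,
      cusumAt n (fun i => φ (Real.log (X i ω) - Real.log (orderStat n k X ω))) l

/-- The cusum statistic with deterministic threshold `b(n/k)`. -/
def cusumDet (n k : ℕ) (X : ℕ → Ω → ℝ) (φ : ℝ → ℝ) (b : ℝ → ℝ) (ω : Ω) : ℝ :=
  (Real.sqrt k)⁻¹ *
    ⨆ l ∈ Finset.Icc 1 n,
      cusumAt n (fun i => φ (Real.log (X i ω) - Real.log (b ((n : ℝ) / k)))) l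

/-- convergence in distribution (weak convergence of laws) of real random variables to
a real random variable `Z` defined on a possibly different probability space -/
def TendstoInDist {Ω' : Type*} [MeasureSpace Ω'] (Y : ℕ → Ω → ℝ) (Z : Ω' → ℝ) : Prop :=
  ∀ f : ℝ → ℝ, Continuous f → (∃ C, ∀ x, |f x| ≤ C) →
    Tendsto (fun n : ℕ => ∫ ω, f (Y n ω)) atTop (nhds (∫ ω, f (Z ω)))

/-- convergence in distribution to a law `μ` on `ℝ` -/
def TendstoInLaw (Y : ℕ → Ω → ℝ) (μ : Measure ℝ) : Prop :=
  ∀ f : ℝ → ℝ, Continuous f → (∃ C, ∀ x, |f x| ≤ C) →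
    Tendsto (fun n : ℕ => ∫ ω, f (Y n ω)) atTop (nhds (∫ x, f x ∂μ))

/-- bounded in probability (`O_P(1)`) -/
def BddInProb (Y : ℕ → Ω → ℝ) : Prop :=
  ∀ ε : ℝ, 0 < ε → ∃ C : ℝ, ∀ᶠ n in atTop,
    ((ℙ : Measure Ω) {ω | C < |Y n ω|}).toReal < ε

/-- divergence to `+∞` in probability -/
def DivergesInProb (Y : ℕ → Ω → ℝ) : Prop :=
  ∀ C : ℝ, Tendsto (fun n : ℕ => ((ℙ : Measure Ω) {ω | Y n ω ≤ C}).toReal) atTop (nhds 0)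

/-- standard Brownian motion on `[0, ∞)` -/
structure IsStdBrownianMotion {Ω' : Type*} [MeasureSpace Ω'] (B : ℝ → Ω' → ℝ) : Prop where
  isProb : IsProbabilityMeasure (ℙ : Measure Ω')
  meas : ∀ t, Measurable (B t)
  start : ∀ᵐ ω ∂(ℙ : Measure Ω'), B 0 ω = 0
  gauss_incr : ∀ s t : ℝ, 0 ≤ s → s ≤ t →
    Measure.map (fun ω => B t ω - B s ω) (ℙ : Measure Ω')
      = gaussianReal 0 (Real.toNNReal (t - s))
  indep_incr : ∀ (n : ℕ) (ts : ℕ → ℝ), (∀ i, 0 ≤ ts i) → Monotone ts →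
    iIndepFun (m := fun _ => Real.measurableSpace)
      (fun i : Fin n => fun ω => B (ts ((i : ℕ) + 1)) ω - B (ts (i : ℕ)) ω)
      (ℙ : Measure Ω')

/-- `sup_{0 ≤ t ≤ 1} |B°(t)|` where `B°(t) = B(t) - t B(1)` is the Brownian bridge
associated with the Brownian motion `B` -/
def supAbsBrownianBridge {Ω' : Type*} [MeasureSpace Ω'] (B : ℝ → Ω' → ℝ) (ω : Ω') : ℝ :=
  ⨆ t : Icc (0 : ℝ) 1, |B (t : ℝ) ω - (t : ℝ) * B 1 ω|

/-- `A_i(ζ) = φ(log X_i - log b(n/k) + ζ/√k)` -/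
def An (X : ℕ → Ω → ℝ) (b : ℝ → ℝ) (φ : ℝ → ℝ) (n k : ℕ) (ζ : ℝ) (i : ℕ) (ω : Ω) : ℝ :=
  φ (Real.log (X i ω) - Real.log (b ((n : ℝ) / k)) + ζ / Real.sqrt k)

/-- the tail sequential process `M_n(t, ζ) = k^{-1/2} Σ_{i=1}^{[nt]} (A_i(ζ) - E A_1(ζ))` -/
def Mn (X : ℕ → Ω → ℝ) (b : ℝ → ℝ) (φ : ℝ → ℝ) (n k : ℕ) (t ζ : ℝ) (ω : Ω) : ℝ :=
  (Real.sqrt k)⁻¹ * ∑ i ∈ Finset.Icc 1 ⌊(n : ℝ) * t⌋₊,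
    (An X b φ n k ζ i ω - ∫ ω', An X b φ n k ζ 1 ω')

/-- residual `ξ̂_i = X_i - Σ_{j=1}^p φ̂_j X_{i-j}` of an AR(p) fit -/
def residual (p : ℕ) (X : ℤ → Ω → ℝ) (φh : Ω → Fin p → ℝ) (i : ℕ) (ω : Ω) : ℝ :=
  X i ω - ∑ j : Fin p, φh ω j * X ((i : ℤ) - ((j : ℕ) + 1)) ω

/-- absolute residual `Ẑ_i = |ξ̂_i|` -/
def Zhat (p : ℕ) (X : ℤ → Ω → ℝ) (φh : Ω → Fin p → ℝ) (i : ℕ) (ω : Ω) : ℝ :=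
  |residual p X φh i ω|

/-- stationarity of the restriction of `Y` to the segment of indices `[a, b]` -/
def SegStationary (a b : ℕ) (Y : ℕ → Ω → ℝ) : Prop :=
  ∀ (m : ℕ) (s : Fin m → ℕ) (j : ℕ), (∀ q, a ≤ s q ∧ s q + j ≤ b) →
    Measure.map (fun ω => fun q : Fin m => Y (s q + j) ω) (ℙ : Measure Ω)
      = Measure.map (fun ω => fun q : Fin m => Y (s q) ω) (ℙ : Measure Ω)

/-- the row-wise mixing coefficient
`β_n(l) = sup_m sup {|P(A∩B) - P(A)P(B)| : A ∈ σ(Y_i : m+l+1 ≤ i ≤ n), B ∈ σ(Y_1,…,Y_m)}` -/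
def betaMixRow (n : ℕ) (Y : ℕ → Ω → ℝ) (lag : ℕ) : ℝ :=
  ⨆ m : ℕ, ⨆ As : Subtype (MeasurableSet : Set (Fin (n - (m + lag)) → ℝ) → Prop),
    ⨆ Bs : Subtype (MeasurableSet : Set (Fin m → ℝ) → Prop),
      |((ℙ : Measure Ω)
          (((fun ω => fun i : Fin (n - (m + lag)) => Y (m + lag + 1 + (i : ℕ)) ω) ⁻¹' As.1)
            ∩ ((fun ω => fun i : Fin m => Y ((i : ℕ) + 1) ω) ⁻¹' Bs.1))).toReal
        - ((ℙ : Measure Ω)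
            ((fun ω => fun i : Fin (n - (m + lag)) => Y (m + lag + 1 + (i : ℕ)) ω) ⁻¹' As.1)).toReal
          * ((ℙ : Measure Ω)
            ((fun ω => fun i : Fin m => Y ((i : ℕ) + 1) ω) ⁻¹' Bs.1)).toReal|

/-- Pointwise eventual bounds along a sequence hold off sets of vanishing measure. -/
theorem tendsto_measure_compl_eventual_bound {f G : ℝ → ℝ} (hf : Measurable f) (hGpos : ∀ y, 0 < G y)
    (hfv : ∀ v, ∃ C, ∀ᶠ y in atTop, |f (v + y) - f y| ≤ C * G y)
    {y : ℕ → ℝ} (hy : Tendsto y atTop atTop) (ρ : Measure ℝ) [IsFiniteMeasure ρ] :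
    (∀ N : ℕ, MeasurableSet {v : ℝ | ∀ m ≥ N, |f (v + y m) - f (y m)| ≤ N * G (y m)}) ∧
    Tendsto (fun N : ℕ => ρ {v : ℝ | ∀ m ≥ N, |f (v + y m) - f (y m)| ≤ N * G (y m)}ᶜ)
      atTop (nhds 0) := by
  have hmeas : ∀ N : ℕ,
      MeasurableSet {v : ℝ | ∀ m ≥ N, |f (v + y m) - f (y m)| ≤ N * G (y m)} := by
    intro N
    simp only [ofPred_forall]
    refine MeasurableSet.iInter fun m => MeasurableSet.iInter fun _ => ?_
    exact measurableSet_le (by fun_prop) measurable_const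
  refine ⟨hmeas, ?_⟩
  have hempty : ⋂ N : ℕ, {v : ℝ | ∀ m ≥ N, |f (v + y m) - f (y m)| ≤ N * G (y m)}ᶜ = ∅ := by
    rw [← compl_iUnion, compl_empty_iff, eq_univ_iff_forall]
    intro v
    obtain ⟨C, hC⟩ := hfv v
    obtain ⟨N₁, hN₁⟩ := eventually_atTop.1 (hy.eventually hC)
    obtain ⟨N₂, hN₂⟩ := exists_nat_ge C
    refine mem_iUnion.2 ⟨max N₁ N₂, fun m hm => (hN₁ m (le_of_max_le_left hm)).trans ?_⟩
    refine mul_le_mul_of_nonneg_right (hN₂.trans ?_) (hGpos _).le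
    exact_mod_cast le_max_right N₁ N₂
  rw [← measure_empty (μ := ρ), ← hempty]
  refine tendsto_measure_iInter_atTop (fun N => (hmeas N).compl.nullMeasurableSet) ?_
    ⟨0, measure_ne_top _ _⟩
  intro N M hNM
  refine compl_subset_compl.2 fun v hv m hm => (hv m (hNM.trans hm)).trans ?_
  exact mul_le_mul_of_nonneg_right (by exact_mod_cast hNM) (hGpos _).le

/-- Uniform boundedness theorem for increments of measurable functions. -/
theorem exists_uniform_increment_bound {f G : ℝ → ℝ} (hf : Measurable f)
    (hGpos : ∀ y, 0 < G y) {A B C₁ : ℝ}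
    (hGu : ∀ᶠ y in atTop, ∀ u ∈ Icc A B, G (u + y) ≤ C₁ * G y)
    (hfv : ∀ v, ∃ C, ∀ᶠ y in atTop, |f (v + y) - f y| ≤ C * G y) :
    ∃ C, ∀ᶠ y in atTop, ∀ u ∈ Icc A B, |f (u + y) - f y| ≤ C * G y := by
  by_contra hcon
  push Not at hcon
  have hex : ∀ n : ℕ, ∃ y u, (n : ℝ) ≤ y ∧ u ∈ Icc A B ∧ n * G y < |f (u + y) - f y| ∧
      G (u + y) ≤ C₁ * G y := by
    intro n
    obtain ⟨y, ⟨u, hu, h1⟩, h2, h3⟩ :=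
      ((hcon n).and_eventually ((eventually_ge_atTop (n : ℝ)).and hGu)).exists
    exact ⟨y, u, h2, hu, h1, h3 u hu⟩
  choose y u hny hu hlt hG using hex
  have hy : Tendsto y atTop atTop := tendsto_atTop_mono hny tendsto_natCast_atTop_atTop
  have huy : Tendsto (fun m => u m + y m) atTop atTop :=
    tendsto_atTop_mono (fun m => add_le_add_left (hu m).1 (y m))
      (tendsto_atTop_add_const_left _ A hy)
  obtain ⟨hVm, hV⟩ := tendsto_measure_compl_eventual_bound hf hGpos hfv hy
    (volume.restrict (Icc A (B + 1)))
  obtain ⟨hWm, hW⟩ := tendsto_measure_compl_eventual_bound hf hGpos hfv huy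
    (volume.restrict (Icc (0 : ℝ) 1))
  have hhalf : (0 : ENNReal) < 1 / 2 := by simp
  obtain ⟨N, hVN, hWN⟩ := ((hV.eventually_lt_const hhalf).and
    (hW.eventually_lt_const hhalf)).exists
  rw [Measure.restrict_apply (hVm N).compl] at hVN
  rw [Measure.restrict_apply (hWm N).compl] at hWN
  obtain ⟨m₀, hm₀⟩ := exists_nat_gt (N * C₁ + N : ℝ)
  set m := max N m₀ with hm
  have hNm : N ≤ m := le_max_left _ _
  have hw : ∃ w ∈ Icc (0 : ℝ) 1,
      (∀ j ≥ N, |f (w + (u j + y j)) - f (u j + y j)| ≤ N * G (u j + y j)) ∧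
      (∀ j ≥ N, |f (w + u m + y j) - f (y j)| ≤ N * G (y j)) := by
    by_contra hno
    push Not at hno
    have hsub : Icc (0 : ℝ) 1 ⊆
        ({v : ℝ | ∀ j ≥ N, |f (v + (u j + y j)) - f (u j + y j)| ≤ N * G (u j + y j)}ᶜ
          ∩ Icc (0 : ℝ) 1) ∪
        (fun w => w + u m) ⁻¹'
          ({v : ℝ | ∀ j ≥ N, |f (v + y j) - f (y j)| ≤ N * G (y j)}ᶜ ∩ Icc A (B + 1)) := by
      intro w hw
      by_cases hwW : ∀ j ≥ N, |f (w + (u j + y j)) - f (u j + y j)| ≤ N * G (u j + y j)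
      · refine Or.inr ⟨fun hv => ?_, ?_⟩
        · obtain ⟨j, hj, hj'⟩ := hno w hw hwW
          exact absurd (hv j hj) (not_le.2 hj')
        · have h1 := (hu m).1
          have h2 := (hu m).2
          exact ⟨by linarith [hw.1], by linarith [hw.2]⟩
      · exact Or.inl ⟨hwW, hw⟩
    have hle := (measure_mono hsub).trans (measure_union_le (μ := volume) _ _)
    rw [measure_preimage_add_right, Real.volume_Icc] at hle
    have hlt1 := ENNReal.add_lt_add hWN hVN
    rw [ENNReal.add_halves] at hlt1
    simp only [sub_zero, ENNReal.ofReal_one] at hle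
    exact absurd (hle.trans_lt hlt1) (lt_irrefl _)
  obtain ⟨w, -, hw1, hw2⟩ := hw
  have e1 := hw1 m hNm
  have e2 := hw2 m hNm
  rw [show w + (u m + y m) = w + u m + y m by ring] at e1
  have e3 : |f (u m + y m) - f (y m)| ≤ N * G (u m + y m) + N * G (y m) := by
    rw [abs_le] at e1 e2 ⊢
    constructor <;> linarith [e1.1, e1.2, e2.1, e2.2]
  have e4 : (N : ℝ) * G (u m + y m) ≤ N * (C₁ * G (y m)) :=
    mul_le_mul_of_nonneg_left (hG m) (Nat.cast_nonneg N)
  have e5 : (m₀ : ℝ) ≤ m := by exact_mod_cast le_max_right _ _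
  have e6 : (N * C₁ + N : ℝ) * G (y m) < m * G (y m) :=
    mul_lt_mul_of_pos_right (hm₀.trans_le e5) (hGpos _)
  linarith [hlt m]

/-- A positive regularly varying function is bounded, relative to its value at `x`,
uniformly over compact dilations of `x`. -/
theorem RegularlyVarying.exists_uniform_bound {g : ℝ → ℝ} {γ : ℝ} (hg : RegularlyVarying g γ)
    (hpos : ∀ x, 0 < g x) {a : ℝ} (b : ℝ) (ha : 0 < a) :
    ∃ C, ∀ᶠ x in atTop, ∀ lam ∈ Icc a b, g (lam * x) ≤ C * g x := by
  have key := exists_uniform_increment_bound (f := fun y => Real.log (g (Real.exp y)))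
    (G := fun _ => 1) (A := Real.log a) (B := Real.log b) (C₁ := 1)
    (Real.measurable_log.comp (hg.1.comp Real.measurable_exp)) (fun _ => one_pos)
    (by simp) (by
      intro v
      have h1 := (hg.2 (Real.exp v) (Real.exp_pos v)).comp Real.tendsto_exp_atTop
      have h2 := (h1.log (Real.rpow_pos_of_pos (Real.exp_pos v) γ).ne').abs
      refine ⟨|Real.log (Real.exp v ^ γ)| + 1, ?_⟩
      filter_upwards [h2.eventually_le_const (lt_add_one _)] with y hy
      rw [← Real.log_div (hpos _).ne' (hpos _).ne', Real.exp_add, mul_one]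
      exact hy)
  obtain ⟨C, hC⟩ := key
  refine ⟨Real.exp C, ?_⟩
  filter_upwards [Real.tendsto_log_atTop.eventually hC, eventually_gt_atTop 0] with x hx hx0 lam hl
  have hl0 : 0 < lam := ha.trans_le hl.1
  have h := hx (Real.log lam) ⟨Real.log_le_log ha hl.1, Real.log_le_log hl0 hl.2⟩
  rw [Real.exp_add, Real.exp_log hl0, Real.exp_log hx0, mul_one,
    ← Real.log_div (hpos _).ne' (hpos _).ne'] at h
  have h' := Real.exp_le_exp.2 ((le_abs_self _).trans h)
  rw [Real.exp_log (div_pos (hpos _) (hpos _)), div_le_iff₀ (hpos _)] at h'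
  exact h'

theorem abs_log_le_two_mul_abs_sub_one {r : ℝ} (hr : |r - 1| ≤ 1 / 2) :
    |Real.log r| ≤ 2 * |r - 1| := by
  have h := abs_le.1 hr
  have hr0 : 0 < r := by linarith
  have h1 := Real.log_le_sub_one_of_pos hr0
  have h2 := Real.one_sub_inv_le_log_of_pos hr0
  have h3 : -(2 * |r - 1|) ≤ 1 - r⁻¹ := by
    rw [show 1 - r⁻¹ = (r - 1) / r by field_simp, le_div_iff₀ hr0]
    rcases abs_cases (r - 1) with ⟨h, _⟩ | ⟨h, _⟩ <;> rw [h] <;> nlinarith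
  rw [abs_le]
  exact ⟨by linarith, by linarith [le_abs_self (r - 1), abs_nonneg (r - 1)]⟩

/-- Under second-order regular variation, `log l(λx) - log l(x) = O(g(x))` uniformly for `λ` in
compact subsets of `(0, ∞)`. -/
theorem SecondOrderRV.exists_uniform_log_bound {l g : ℝ → ℝ} {K γ : ℝ} (h : SecondOrderRV l g K γ)
    (hl : SlowlyVarying l) {a b : ℝ} (ha : 0 < a) (hb : 0 < b) :
    ∃ C, ∀ᶠ x in atTop, ∀ lam ∈ Icc a b, |Real.log (l (lam * x)) - Real.log (l x)| ≤ C * g x := by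
  obtain ⟨-, hpos, hg, hlim⟩ := h
  obtain ⟨C₁, hC₁⟩ := hg.exists_uniform_bound hpos b ha
  have key := exists_uniform_increment_bound (f := fun y => Real.log (l (Real.exp y)))
    (G := fun y => g (Real.exp y)) (A := Real.log a) (B := Real.log b) (C₁ := C₁)
    (Real.measurable_log.comp (hl.1.comp Real.measurable_exp)) (fun _ => hpos _)
    (by
      filter_upwards [Real.tendsto_exp_atTop.eventually hC₁] with y hy u hu
      rw [Real.exp_add]
      exact hy _ ⟨(Real.log_le_iff_le_exp ha).1 hu.1, (Real.le_log_iff_exp_le hb).1 hu.2⟩)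
    (by
      intro v
      have h1 := (hlim (Real.exp v) (Real.exp_pos v)).comp Real.tendsto_exp_atTop
      have h3 := (hl.2 (Real.exp v) (Real.exp_pos v)).comp Real.tendsto_exp_atTop
      refine ⟨2 * (|kappaFun K γ (Real.exp v)| + 1), ?_⟩
      filter_upwards [h1.abs.eventually_le_const (lt_add_one _),
        h3.eventually (Metric.closedBall_mem_nhds (1 : ℝ) (by norm_num : (0 : ℝ) < 1 / 2))]
        with y hy hy'
      simp only [Function.comp, Real.dist_eq] at hy hy'
      have hr0 : l (Real.exp v * Real.exp y) / l (Real.exp y) ≠ 0 := by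
        intro h0
        rw [h0] at hy'
        norm_num at hy'
      rw [Real.exp_add, ← Real.log_div (div_ne_zero_iff.1 hr0).1 (div_ne_zero_iff.1 hr0).2]
      refine (abs_log_le_two_mul_abs_sub_one hy').trans ?_
      rw [abs_div, abs_of_pos (hpos _), div_le_iff₀ (hpos _)] at hy
      linarith)
  obtain ⟨C, hC⟩ := key
  refine ⟨C, ?_⟩
  filter_upwards [Real.tendsto_log_atTop.eventually hC, eventually_gt_atTop 0] with x hx hx0 lam hl
  have hl0 : 0 < lam := ha.trans_le hl.1
  have h := hx (Real.log lam) ⟨Real.log_le_log ha hl.1, Real.log_le_log hl0 hl.2⟩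
  rwa [Real.exp_add, Real.exp_log hl0, Real.exp_log hx0] at h

theorem tailDF_antitone (μ : Measure ℝ) [IsFiniteMeasure μ] : Antitone (tailDF μ) :=
  fun _ _ h => measureReal_mono (Ioi_subset_Ioi h)

theorem tailDF_nonneg (μ : Measure ℝ) (x : ℝ) : 0 ≤ tailDF μ x := ENNReal.toReal_nonneg

theorem df_add_tailDF (μ : Measure ℝ) [IsProbabilityMeasure μ] (x : ℝ) :
    df μ x + tailDF μ x = 1 := by
  have h := probReal_compl_eq_one_sub (μ := μ) (measurableSet_Iic (a := x))
  rw [compl_Iic] at h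
  change μ.real (Iic x) + μ.real (Ioi x) = 1
  linarith

theorem ParetoTail.pos {μ : Measure ℝ} [IsFiniteMeasure μ] {α : ℝ} {l : ℝ → ℝ}
    (h : ParetoTail μ α l) (x : ℝ) : 0 < tailDF μ x := by
  have h1 := h.1.2 1 one_pos
  simp only [one_mul] at h1
  have h2 : ∀ᶠ x in atTop, l x / l x ≠ 0 := h1.eventually_ne one_ne_zero
  obtain ⟨y, hy, hxy, hy0⟩ :=
    (h2.and ((eventually_ge_atTop x).and (eventually_gt_atTop 0))).exists
  refine lt_of_lt_of_le ?_ (tailDF_antitone μ hxy)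
  refine lt_of_le_of_ne (tailDF_nonneg μ y) (Ne.symm ?_)
  rw [h.2 y hy0]
  exact mul_ne_zero (Real.rpow_pos_of_pos hy0 _).ne' (div_ne_zero_iff.1 hy).1

theorem ParetoTail.slowlyVarying_pos {μ : Measure ℝ} [IsFiniteMeasure μ] {α : ℝ} {l : ℝ → ℝ}
    (h : ParetoTail μ α l) {x : ℝ} (hx : 0 < x) : 0 < l x := by
  have h1 := h.pos x
  rw [h.2 x hx] at h1
  exact pos_of_mul_pos_right h1 (Real.rpow_nonneg hx.le _)

theorem ParetoTail.tendsto_ratio {μ : Measure ℝ} {α : ℝ} {l : ℝ → ℝ}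
    (h : ParetoTail μ α l) {lam : ℝ} (hlam : 0 < lam) :
    Tendsto (fun x => tailDF μ (lam * x) / tailDF μ x) atTop (nhds (lam ^ (-α))) := by
  have h1 := (h.1.2 lam hlam).const_mul (lam ^ (-α))
  rw [mul_one] at h1
  refine h1.congr' ?_
  filter_upwards [eventually_gt_atTop 0] with x hx
  have hx' := (Real.rpow_pos_of_pos hx (-α)).ne'
  rw [h.2 _ (mul_pos hlam hx), h.2 _ hx, Real.mul_rpow hlam.le hx.le]
  field_simp

/-- Geometric decay of a Pareto-type tail along dilations. -/
theorem ParetoTail.exists_geometric_bound {μ : Measure ℝ} [IsFiniteMeasure μ] {α : ℝ} {l : ℝ → ℝ}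
    (h : ParetoTail μ α l) (hα : 0 < α) {τ : ℝ} (hτ : 1 < τ) :
    ∃ θ, 0 < θ ∧ θ < 1 ∧ ∃ x₀, 0 < x₀ ∧ ∀ x ≥ x₀, ∀ j : ℕ,
      tailDF μ (τ ^ j * x) ≤ θ ^ j * tailDF μ x := by
  have hτ0 : 0 < τ := one_pos.trans hτ
  have hlt : τ ^ (-α) < 1 := Real.rpow_lt_one_of_one_lt_of_neg hτ (by linarith)
  obtain ⟨θ, h1, h2⟩ := exists_between hlt
  obtain ⟨x₀, hx₀⟩ := eventually_atTop.1 ((h.tendsto_ratio hτ0).eventually_le_const h1)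
  have hθ : 0 < θ := (Real.rpow_pos_of_pos hτ0 _).trans h1
  refine ⟨θ, hθ, h2, max x₀ 1, by positivity, fun x hx j => ?_⟩
  induction j with
  | zero => simp
  | succ j ih =>
    have hx1 : 1 ≤ x := (le_max_right _ _).trans hx
    have hge : x₀ ≤ τ ^ j * x :=
      ((le_max_left _ _).trans hx).trans
        (le_mul_of_one_le_left (by linarith) (one_le_pow₀ hτ.le))
    have h3 := (div_le_iff₀ (h.pos _)).1 (hx₀ _ hge)
    calc tailDF μ (τ ^ (j + 1) * x) = tailDF μ (τ * (τ ^ j * x)) := by ring_nf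
      _ ≤ θ * tailDF μ (τ ^ j * x) := h3
      _ ≤ θ * (θ ^ j * tailDF μ x) := mul_le_mul_of_nonneg_left ih hθ.le
      _ = θ ^ (j + 1) * tailDF μ x := by ring

theorem tendsto_tailDF_zero (μ : Measure ℝ) [IsFiniteMeasure μ] :
    Tendsto (tailDF μ) atTop (nhds 0) := by
  have hE : ⋂ x : ℝ, Ioi x = ∅ := by
    rw [eq_empty_iff_forall_notMem]
    intro y hy
    exact lt_irrefl y (mem_iInter.1 hy y)
  have h := tendsto_measure_iInter_atTop (μ := μ) (s := fun x : ℝ => Ioi x)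
    (fun x => measurableSet_Ioi.nullMeasurableSet) (fun _ _ h => Ioi_subset_Ioi h)
    ⟨0, measure_ne_top _ _⟩
  rw [hE, measure_empty] at h
  exact (ENNReal.tendsto_toReal ENNReal.zero_ne_top).comp h

/-- For `x > 1`, the quantile function satisfies `F̄(b(x)) ≤ 1/x`. -/
theorem tailDF_quantileB_le {μ : Measure ℝ} [IsProbabilityMeasure μ] {x : ℝ}
    (hx : 1 < x) : tailDF μ (quantileB μ x) ≤ x⁻¹ := by
  have hxi : x⁻¹ < 1 := inv_lt_one_of_one_lt₀ hx
  have hxp : 0 < x⁻¹ := by positivity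
  have hne : {y : ℝ | 1 - x⁻¹ ≤ df μ y}.Nonempty := by
    obtain ⟨y, hy⟩ := ((tendsto_tailDF_zero μ).eventually_le_const hxp).exists
    exact ⟨y, by have := df_add_tailDF μ y; change 1 - x⁻¹ ≤ df μ y; linarith⟩
  have key : ∀ y > quantileB μ x, tailDF μ y ≤ x⁻¹ := by
    intro y hy
    obtain ⟨z, hz, hzy⟩ := exists_lt_of_csInf_lt hne hy
    have h1 := df_add_tailDF μ z
    have h2 := tailDF_antitone μ hzy.le
    change 1 - x⁻¹ ≤ df μ z at hz
    linarith
  have hU : ⋃ n : ℕ, Ioi (quantileB μ x + 1 / ((n : ℝ) + 1)) = Ioi (quantileB μ x) := by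
    ext y
    simp only [mem_iUnion, mem_Ioi]
    constructor
    · rintro ⟨n, hn⟩
      have : (0 : ℝ) < 1 / ((n : ℝ) + 1) := by positivity
      linarith
    · intro h
      obtain ⟨n, hn⟩ := exists_nat_one_div_lt (sub_pos.2 h)
      exact ⟨n, by linarith⟩
  have hmono : Monotone fun n : ℕ => Ioi (quantileB μ x + 1 / ((n : ℝ) + 1)) := by
    intro n m hnm
    refine Ioi_subset_Ioi (add_le_add_right ?_ _)
    exact one_div_le_one_div_of_le (by positivity) (by exact_mod_cast Nat.succ_le_succ hnm)
  have hT := tendsto_measure_iUnion_atTop (μ := μ) hmono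
  rw [hU] at hT
  refine le_of_tendsto' ((ENNReal.tendsto_toReal (measure_ne_top _ _)).comp hT) fun n => ?_
  have : (0 : ℝ) < 1 / ((n : ℝ) + 1) := by positivity
  exact key _ (by linarith)

theorem ParetoTail.tendsto_quantileB {μ : Measure ℝ} [IsProbabilityMeasure μ] {α : ℝ} {l : ℝ → ℝ}
    (h : ParetoTail μ α l) : Tendsto (quantileB μ) atTop atTop := by
  refine tendsto_atTop.2 fun y => ?_
  have hinv : ∀ᶠ x : ℝ in atTop, x⁻¹ < tailDF μ y :=
    tendsto_inv_atTop_zero.eventually_lt_const (h.pos y)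
  filter_upwards [hinv, eventually_gt_atTop 1] with x hx hx1
  have hxp : 0 < x⁻¹ := by positivity
  have hne : {y : ℝ | 1 - x⁻¹ ≤ df μ y}.Nonempty := by
    obtain ⟨y, hy⟩ := ((tendsto_tailDF_zero μ).eventually_le_const hxp).exists
    exact ⟨y, by have := df_add_tailDF μ y; change 1 - x⁻¹ ≤ df μ y; linarith⟩
  refine le_csInf hne fun z hz => ?_
  by_contra hzy
  have h1 := df_add_tailDF μ z
  have h2 := tailDF_antitone μ (not_le.1 hzy).le
  change 1 - x⁻¹ ≤ df μ z at hz
  linarith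

/-- Lipschitz-type bound for the increments of a second-order regularly varying tail. -/
theorem ParetoTail.exists_increment_bound {μ : Measure ℝ} [IsProbabilityMeasure μ] {α : ℝ}
    (hα : 0 < α) {l g : ℝ → ℝ} {K γ : ℝ} (h : ParetoTail μ α l) (hg : SecondOrderRV l g K γ)
    {a b : ℝ} (ha : 0 < a) (hb : 0 < b) :
    ∃ D, 0 < D ∧ ∀ᶠ y in atTop, ∀ x ∈ Icc a b, ∀ x' ∈ Icc a b, x ≤ x' →
      tailDF μ (x * y) - tailDF μ (x' * y) ≤ D * tailDF μ y * (x' - x + g y) := by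
  obtain ⟨C, hC⟩ := hg.exists_uniform_log_bound h.1 ha hb
  have hr := (h.tendsto_ratio ha).eventually_le_const (lt_add_one (a ^ (-α)))
  have ha' : 0 < a ^ (-α) := Real.rpow_pos_of_pos ha _
  refine ⟨(a ^ (-α) + 1) * (α / a + 2 * |C|), by positivity, ?_⟩
  filter_upwards [hC, hr, eventually_gt_atTop 0] with y hy hry hy0 x hx x' hx' hxx
  have hx0 : 0 < x := ha.trans_le hx.1
  have hx0' : 0 < x' := ha.trans_le hx'.1
  have hgy := hg.2.1 y
  have hl := h.slowlyVarying_pos (mul_pos hx0 hy0)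
  have hl' := h.slowlyVarying_pos (mul_pos hx0' hy0)
  have e1 : tailDF μ (x' * y) / tailDF μ (x * y) = Real.exp (-α * (Real.log x' - Real.log x) +
      (Real.log (l (x' * y)) - Real.log (l (x * y)))) := by
    rw [h.2 _ (mul_pos hx0 hy0), h.2 _ (mul_pos hx0' hy0), Real.exp_add, Real.exp_sub,
      Real.exp_log hl, Real.exp_log hl', mul_sub, Real.exp_sub, mul_comm (-α), mul_comm (-α),
      ← Real.rpow_def_of_pos hx0, ← Real.rpow_def_of_pos hx0', Real.mul_rpow hx0.le hy0.le,
      Real.mul_rpow hx0'.le hy0.le]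
    have := (Real.rpow_pos_of_pos hy0 (-α)).ne'
    have := (Real.rpow_pos_of_pos hx0 (-α)).ne'
    field_simp
  have e2 : Real.log x' - Real.log x ≤ (x' - x) / a := by
    rw [← Real.log_div hx0'.ne' hx0.ne']
    refine (Real.log_le_sub_one_of_pos (div_pos hx0' hx0)).trans ?_
    rw [show x' / x - 1 = (x' - x) / x by field_simp]
    exact div_le_div_of_nonneg_left (by linarith) ha hx.1
  have e3 := abs_le.1 (hy x hx)
  have e4 := abs_le.1 (hy x' hx')
  have e5 : C * g y ≤ |C| * g y := mul_le_mul_of_nonneg_right (le_abs_self C) hgy.le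
  have e6 : 1 - (α / a * (x' - x) + 2 * |C| * g y) ≤ tailDF μ (x' * y) / tailDF μ (x * y) := by
    rw [e1]
    refine le_trans ?_ (Real.add_one_le_exp _)
    have := mul_le_mul_of_nonneg_left e2 hα.le
    have e7 : α / a * (x' - x) = α * ((x' - x) / a) := by ring
    linarith [e3.2, e4.1]
  rw [le_div_iff₀ (h.pos _)] at e6
  have e8 : tailDF μ (x * y) ≤ (a ^ (-α) + 1) * tailDF μ y :=
    (tailDF_antitone μ (mul_le_mul_of_nonneg_right hx.1 hy0.le)).trans
      ((div_le_iff₀ (h.pos _)).1 hry)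
  have hd : 0 ≤ x' - x := by linarith
  have e9 : α / a * (x' - x) + 2 * |C| * g y ≤ (α / a + 2 * |C|) * (x' - x + g y) := by
    have h1 : 0 ≤ α / a * g y := by positivity
    have h2 : 0 ≤ 2 * |C| * (x' - x) := by positivity
    linarith
  have hn1 : 0 ≤ α / a * (x' - x) + 2 * |C| * g y := by positivity
  calc tailDF μ (x * y) - tailDF μ (x' * y)
      ≤ tailDF μ (x * y) * (α / a * (x' - x) + 2 * |C| * g y) := by linarith
    _ ≤ ((a ^ (-α) + 1) * tailDF μ y) * ((α / a + 2 * |C|) * (x' - x + g y)) :=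
        mul_le_mul e8 e9 hn1 (mul_nonneg (by positivity) (tailDF_nonneg _ _))
    _ = _ := by ring

section Autoregression

variable {S : Type*}

/-- The backshift operator on processes. -/
def backshift (S : Type*) : Module.End ℂ (ℤ → S → ℂ) :=
  LinearMap.funLeft ℂ (S → ℂ) (fun i : ℤ => i - 1)

theorem backshift_apply (U : ℤ → S → ℂ) (i : ℤ) : backshift S U i = U (i - 1) := rfl

theorem backshift_pow_apply (n : ℕ) (U : ℤ → S → ℂ) (i : ℤ) :
    (backshift S ^ n) U i = U (i - n) := by
  induction n generalizing i with
  | zero => simp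
  | succ n ih =>
    rw [pow_succ', Module.End.mul_apply, backshift_apply, ih]
    congr 1
    push_cast
    ring

variable [MeasurableSpace S] {P : Measure S}

/-- The tails of `U i` are dominated by `H`, up to constants uniform in `i`. -/
def TailDominated (P : Measure S) (H : ℝ → ℝ) (U : ℤ → S → ℂ) : Prop :=
  ∃ L > 0, ∃ C ≥ 0, ∃ y₀, ∀ i, ∀ y ≥ y₀, P.real {ω | L * y < ‖U i ω‖} ≤ C * H y

/-- Uniform tightness of a family of complex random variables. -/
def UniformlyTight (P : Measure S) (U : ℤ → S → ℂ) : Prop :=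
  ∀ ε > 0, ∃ K, ∀ i, P.real {ω | K < ‖U i ω‖} ≤ ε

theorem UniformlyTight.shift {U : ℤ → S → ℂ} (h : UniformlyTight P U) (n : ℕ) :
    UniformlyTight P ((backshift S ^ n) U) := by
  intro ε hε
  obtain ⟨K, hK⟩ := h ε hε
  exact ⟨K, fun i => by simpa only [backshift_pow_apply] using hK (i - n)⟩

theorem UniformlyTight.smul [IsFiniteMeasure P] {U : ℤ → S → ℂ} (h : UniformlyTight P U) (c : ℂ) :
    UniformlyTight P (c • U) := by
  intro ε hε
  obtain ⟨K, hK⟩ := h ε hε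
  refine ⟨‖c‖ * K, fun i => le_trans (measureReal_mono ?_) (hK i)⟩
  intro ω hω
  simp only [Pi.smul_apply, smul_eq_mul, norm_mul, mem_ofPred_eq] at hω ⊢
  exact lt_of_mul_lt_mul_left hω (norm_nonneg c)

theorem UniformlyTight.add [IsFiniteMeasure P] {U V : ℤ → S → ℂ} (hU : UniformlyTight P U)
    (hV : UniformlyTight P V) : UniformlyTight P (U + V) := by
  intro ε hε
  obtain ⟨K, hK⟩ := hU (ε / 2) (half_pos hε)
  obtain ⟨K', hK'⟩ := hV (ε / 2) (half_pos hε)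
  refine ⟨K + K', fun i => ?_⟩
  have hsub : {ω | K + K' < ‖(U + V) i ω‖} ⊆ {ω | K < ‖U i ω‖} ∪ {ω | K' < ‖V i ω‖} := by
    intro ω hω
    by_contra hno
    simp only [mem_union, mem_ofPred_eq, not_or, not_lt, Pi.add_apply] at hω hno
    linarith [norm_add_le (U i ω) (V i ω)]
  have := (measureReal_mono hsub).trans (measureReal_union_le (μ := P) _ _)
  linarith [hK i, hK' i]

theorem UniformlyTight.aeval [IsFiniteMeasure P] {U : ℤ → S → ℂ} (h : UniformlyTight P U)
    (Q : Polynomial ℂ) : UniformlyTight P (Polynomial.aeval (backshift S) Q U) := by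
  induction Q using Polynomial.induction_on' with
  | add p q hp hq => simpa only [map_add, LinearMap.add_apply] using hp.add hq
  | monomial n c =>
    rw [Polynomial.aeval_monomial, Module.End.mul_apply, Module.algebraMap_end_apply]
    exact (h.shift n).smul c

/-- A tight causal AR(1) filter of a tail-dominated process is tail-dominated. -/
theorem TailDominated.of_autoregression [IsFiniteMeasure P] {H : ℝ → ℝ} (hH0 : ∀ y, 0 ≤ H y)
    (hgeo : ∀ τ > 1, ∃ θ, 0 < θ ∧ θ < 1 ∧ ∃ x₀, 0 < x₀ ∧ ∀ x ≥ x₀, ∀ j : ℕ,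
      H (τ ^ j * x) ≤ θ ^ j * H x)
    {U V : ℤ → S → ℂ} {a : ℂ} (ha0 : a ≠ 0) (ha : ‖a‖ < 1)
    (hrec : ∀ i ω, V i ω = a * V (i - 1) ω + U i ω)
    (hU : TailDominated P H U) (hV : UniformlyTight P V) : TailDominated P H V := by
  obtain ⟨L, hL, C, hC, y₀, hUb⟩ := hU
  have hq0 : 0 < ‖a‖ := norm_pos_iff.2 ha0
  set s := Real.sqrt ‖a‖ with hs
  have hs0 : 0 < s := Real.sqrt_pos.2 hq0
  have hs1 : s < 1 := by rw [hs, Real.sqrt_lt' one_pos]; simpa using ha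
  have hss : ‖a‖ = s * s := (Real.mul_self_sqrt hq0.le).symm
  obtain ⟨θ, hθ0, hθ1, x₀, hx₀, hθ⟩ := hgeo s⁻¹ ((one_lt_inv₀ hs0).2 hs1)
  have hexp : ∀ (m : ℕ) i ω,
      V i ω = ∑ j ∈ Finset.range m, a ^ j * U (i - j) ω + a ^ m * V (i - m) ω := by
    intro m i ω
    induction m with
    | zero => simp
    | succ m ih =>
      rw [ih, Finset.sum_range_succ, hrec (i - m) ω,
        show i - ((m + 1 : ℕ) : ℤ) = i - m - 1 by push_cast; ring]
      ring
  refine ⟨L / (1 - s) + 1, by have : 0 < 1 - s := by linarith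
                              positivity, C / (1 - θ), div_nonneg hC (by linarith),
    max y₀ x₀, fun i y hy => ?_⟩
  have hyy : y₀ ≤ y := (le_max_left _ _).trans hy
  have hyx : x₀ ≤ y := (le_max_right _ _).trans hy
  have hy0 : 0 < y := hx₀.trans_le hyx
  refine le_of_forall_pos_le_add fun ε hε => ?_
  obtain ⟨K, hK⟩ := hV ε hε
  obtain ⟨m, hm⟩ := exists_pow_lt_of_lt_one (show 0 < y / (|K| + 1) by positivity) ha
  have hKm : K * ‖a‖ ^ m ≤ y := by
    rw [lt_div_iff₀ (by positivity)] at hm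
    have : 0 < ‖a‖ ^ m := by positivity
    nlinarith [le_abs_self K]
  have hsub : {ω | (L / (1 - s) + 1) * y < ‖V i ω‖} ⊆
      (⋃ j ∈ Finset.range m, {ω | L * (s⁻¹ ^ j * y) < ‖U (i - j) ω‖}) ∪
        {ω | K < ‖V (i - m) ω‖} := by
    intro ω hω
    by_contra hno
    simp only [mem_union, mem_iUnion, mem_ofPred_eq, not_or, not_exists, not_lt] at hω hno
    obtain ⟨h1, h2⟩ := hno
    have h3 : ‖∑ j ∈ Finset.range m, a ^ j * U (i - j) ω‖ ≤ L / (1 - s) * y := by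
      calc ‖∑ j ∈ Finset.range m, a ^ j * U (i - j) ω‖
          ≤ ∑ j ∈ Finset.range m, L * y * s ^ j := by
            refine norm_sum_le_of_le _ fun j hj => ?_
            rw [norm_mul, norm_pow, hss, mul_pow]
            calc s ^ j * s ^ j * ‖U (i - j) ω‖ ≤ s ^ j * s ^ j * (L * (s⁻¹ ^ j * y)) :=
                  mul_le_mul_of_nonneg_left (h1 j hj) (by positivity)
              _ = L * y * s ^ j := by
                  rw [inv_pow]
                  have := (pow_pos hs0 j).ne'
                  field_simp
        _ = L * y * ∑ j ∈ Finset.range m, s ^ j := by rw [Finset.mul_sum]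
        _ ≤ L * y * (1 - s)⁻¹ := by
            refine mul_le_mul_of_nonneg_left ?_ (by positivity)
            rw [← tsum_geometric_of_lt_one hs0.le hs1]
            exact (summable_geometric_of_lt_one hs0.le hs1).sum_le_tsum _
              (fun _ _ => by positivity)
        _ = L / (1 - s) * y := by ring
    have h4 : ‖a ^ m * V (i - m) ω‖ ≤ y := by
      rw [norm_mul, norm_pow]
      calc ‖a‖ ^ m * ‖V (i - m) ω‖ ≤ ‖a‖ ^ m * K := mul_le_mul_of_nonneg_left h2 (by positivity)
        _ ≤ y := by linarith
    rw [hexp m i ω] at hω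
    have := norm_add_le (∑ j ∈ Finset.range m, a ^ j * U (i - j) ω) (a ^ m * V (i - m) ω)
    linarith
  refine (measureReal_mono hsub).trans ((measureReal_union_le _ _).trans ?_)
  refine add_le_add ((measureReal_biUnion_finset_le _ _).trans ?_) (hK _)
  calc ∑ j ∈ Finset.range m, P.real {ω | L * (s⁻¹ ^ j * y) < ‖U (i - j) ω‖}
      ≤ ∑ j ∈ Finset.range m, C * H y * θ ^ j := by
        refine Finset.sum_le_sum fun j _ => ?_
        have hge : y ≤ s⁻¹ ^ j * y :=
          le_mul_of_one_le_left hy0.le (one_le_pow₀ ((one_lt_inv₀ hs0).2 hs1).le)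
        refine (hUb _ _ (hyy.trans hge)).trans ?_
        have := mul_le_mul_of_nonneg_left (hθ y hyx j) hC
        linarith
    _ = C * H y * ∑ j ∈ Finset.range m, θ ^ j := by rw [Finset.mul_sum]
    _ ≤ C * H y * (1 - θ)⁻¹ := by
        refine mul_le_mul_of_nonneg_left ?_ (mul_nonneg hC (hH0 y))
        rw [← tsum_geometric_of_lt_one hθ0.le hθ1]
        exact (summable_geometric_of_lt_one hθ0.le hθ1).sum_le_tsum _
          (fun _ _ => by positivity)
    _ = C / (1 - θ) * H y := by ring

/-- A tight process is tail-dominated as soon as its image under a polynomial in the backshift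
with all roots outside the closed unit disc is. -/
theorem TailDominated.of_aeval [IsFiniteMeasure P] {H : ℝ → ℝ} (hH0 : ∀ y, 0 ≤ H y)
    (hgeo : ∀ τ > 1, ∃ θ, 0 < θ ∧ θ < 1 ∧ ∃ x₀, 0 < x₀ ∧ ∀ x ≥ x₀, ∀ j : ℕ,
      H (τ ^ j * x) ≤ θ ^ j * H x)
    {U : ℤ → S → ℂ} (hU : UniformlyTight P U) {Q : Polynomial ℂ} (hQ0 : Q ≠ 0)
    (hQ : ∀ r, Q.IsRoot r → 1 < ‖r‖)
    (hd : TailDominated P H (Polynomial.aeval (backshift S) Q U)) : TailDominated P H U := by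
  induction hn : Q.natDegree generalizing Q with
  | zero =>
    obtain ⟨c, rfl⟩ := Polynomial.natDegree_eq_zero.1 hn
    have hc : c ≠ 0 := by simpa using hQ0
    obtain ⟨L, hL, C, hC, y₀, hb⟩ := hd
    have hc' : 0 < ‖c‖ := norm_pos_iff.2 hc
    refine ⟨L / ‖c‖, by positivity, C, hC, y₀, fun i y hy => le_trans (measureReal_mono ?_)
      (hb i y hy)⟩
    intro ω hω
    simp only [Polynomial.aeval_C, Module.algebraMap_end_apply, Pi.smul_apply, smul_eq_mul,
      norm_mul, mem_ofPred_eq] at hω ⊢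
    rw [div_mul_eq_mul_div, div_lt_iff₀ hc'] at hω
    linarith
  | succ n ih =>
    have hdeg : Q.degree ≠ 0 := by
      rw [Polynomial.degree_eq_natDegree hQ0, hn]
      exact_mod_cast Nat.succ_ne_zero n
    obtain ⟨r, hr⟩ := IsAlgClosed.exists_root Q hdeg
    obtain ⟨R, rfl⟩ := Polynomial.dvd_iff_isRoot.2 hr
    have hR0 : R ≠ 0 := right_ne_zero_of_mul hQ0
    have hr1 := hQ r hr
    have hr0 : r ≠ 0 := norm_pos_iff.1 (one_pos.trans hr1)
    refine ih hR0 (fun z hz => hQ z ?_) ?_ ?_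
    · exact Polynomial.root_mul_left_of_isRoot _ hz
    · set V := Polynomial.aeval (backshift S) R U with hV
      obtain ⟨L, hL, C, hC, y₀, hb⟩ := hd
      have hW : ∀ i ω, Polynomial.aeval (backshift S) ((Polynomial.X - Polynomial.C r) * R) U i ω
          = V (i - 1) ω - r * V i ω := by
        intro i ω
        simp [hV, Module.End.mul_apply, backshift_apply, Module.algebraMap_end_apply]
      refine TailDominated.of_autoregression hH0 hgeo (a := r⁻¹)
        (U := fun i ω => -r⁻¹ * (V (i - 1) ω - r * V i ω)) (inv_ne_zero hr0)
        (by rw [norm_inv]; exact inv_lt_one_of_one_lt₀ hr1) ?_ ?_ (hU.aeval R)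
      · intro i ω
        field_simp
        ring
      · refine ⟨‖r⁻¹‖ * L, mul_pos (norm_pos_iff.2 (inv_ne_zero hr0)) hL, C, hC, y₀,
          fun i y hy => le_trans (measureReal_mono ?_) (hb i y hy)⟩
        intro ω hω
        simp only [mem_ofPred_eq, hW] at hω ⊢
        rw [norm_mul, norm_neg, mul_assoc] at hω
        exact lt_of_mul_lt_mul_left hω (norm_nonneg _)
    · rw [Polynomial.natDegree_mul (Polynomial.X_sub_C_ne_zero r) hR0,
        Polynomial.natDegree_X_sub_C] at hn
      omega

end Autoregression

section RandomWalk

variable {S : Type*} [MeasurableSpace S] {P : Measure S}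

/-- Ottaviani's maximal inequality for sums of independent complex random variables. -/
theorem measureReal_exists_partial_sum_gt_le [IsProbabilityMeasure P] {η : ℕ → S → ℂ}
    (hη : ∀ m, Measurable (η m)) (hind : iIndepFun η P) {K : ℝ} (hK0 : 0 ≤ K) {n : ℕ}
    (hK : ∀ m ≤ n, P.real {ω | K < ‖∑ i ∈ Finset.Ico m n, η i ω‖} ≤ 1 / 4) :
    P.real {ω | ∃ m ≤ n, 2 * K < ‖∑ i ∈ Finset.range m, η i ω‖} ≤ 1 / 2 := by
  have hsum : ∀ s : Finset ℕ, Measurable fun ω => ∑ i ∈ s, η i ω := fun s =>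
    Finset.measurable_sum s fun i _ => hη i
  have hgt : ∀ c : ℝ, MeasurableSet {z : ℂ | c < ‖z‖} := fun c =>
    measurableSet_lt measurable_const measurable_norm
  set F := {ω | K < ‖∑ i ∈ Finset.range n, η i ω‖} with hF
  have hFm : MeasurableSet F := measurableSet_lt measurable_const (hsum _).norm
  have hstep : ∀ m ≤ n, 3 / 4 * P.real {ω | ∃ j ≤ m, 2 * K < ‖∑ i ∈ Finset.range j, η i ω‖} ≤
      P.real ({ω | ∃ j ≤ m, 2 * K < ‖∑ i ∈ Finset.range j, η i ω‖} ∩ F) := by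
    intro m
    induction m with
    | zero =>
      intro _
      have : {ω | ∃ j ≤ 0, 2 * K < ‖∑ i ∈ Finset.range j, η i ω‖} = ∅ := by
        rw [eq_empty_iff_forall_notMem]
        rintro ω ⟨j, hj, hlt⟩
        obtain rfl := Nat.le_zero.1 hj
        simp at hlt
        linarith
      rw [this]
      simp
    | succ m ih =>
      intro hm
      set B := {ω | ∃ j ≤ m, 2 * K < ‖∑ i ∈ Finset.range j, η i ω‖} with hB
      set A := {ω | 2 * K < ‖∑ i ∈ Finset.range (m + 1), η i ω‖} \ B with hA
      set D := {ω | ‖∑ i ∈ Finset.Ico (m + 1) n, η i ω‖ ≤ K} with hD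
      have hsplit : {ω | ∃ j ≤ m + 1, 2 * K < ‖∑ i ∈ Finset.range j, η i ω‖} = B ∪ A := by
        ext ω
        simp only [hA, hB, mem_union, Set.mem_sdiff, mem_ofPred_eq]
        constructor
        · rintro ⟨j, hj, hlt⟩
          by_cases hb : ∃ j ≤ m, 2 * K < ‖∑ i ∈ Finset.range j, η i ω‖
          · exact Or.inl hb
          · rcases Nat.le_succ_iff.1 hj with h | rfl
            · exact absurd ⟨j, h, hlt⟩ hb
            · exact Or.inr ⟨hlt, hb⟩
        · rintro (⟨j, hj, hlt⟩ | ⟨hlt, -⟩)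
          · exact ⟨j, hj.trans (Nat.le_succ m), hlt⟩
          · exact ⟨m + 1, le_rfl, hlt⟩
      have hpast : ∀ j ≤ m + 1, Measurable[⨆ i ∈ Iio (m + 1), MeasurableSpace.comap (η i) inferInstance]
          fun ω => ∑ i ∈ Finset.range j, η i ω := by
        intro j hj
        refine Finset.measurable_sum _ fun i hi => ?_
        have hi' : i ∈ Iio (m + 1) := (Finset.mem_range.1 hi).trans_le hj
        exact (comap_measurable (η i)).mono
          (le_iSup₂ (f := fun i (_ : i ∈ Iio (m + 1)) =>
            MeasurableSpace.comap (η i) inferInstance) i hi') le_rfl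
      have hBpast : MeasurableSet[⨆ i ∈ Iio (m + 1), MeasurableSpace.comap (η i) inferInstance] B := by
        have hBe : B = ⋃ j, ⋃ (_ : j ≤ m), {ω | 2 * K < ‖∑ i ∈ Finset.range j, η i ω‖} := by
          ext ω
          simp [hB]
        rw [hBe]
        refine MeasurableSet.iUnion fun j => MeasurableSet.iUnion fun hj => ?_
        exact hpast j (hj.trans (Nat.le_succ m)) (hgt (2 * K))
      have hApast : MeasurableSet[⨆ i ∈ Iio (m + 1), MeasurableSpace.comap (η i) inferInstance] A :=
        MeasurableSet.diff (hpast (m + 1) le_rfl (hgt (2 * K))) hBpast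
      have hDfut : MeasurableSet[⨆ i ∈ Ici (m + 1), MeasurableSpace.comap (η i) inferInstance] D := by
        suffices hs : Measurable[⨆ i ∈ Ici (m + 1), MeasurableSpace.comap (η i) inferInstance]
            fun ω => ∑ i ∈ Finset.Ico (m + 1) n, η i ω from
          hs (measurableSet_le measurable_norm measurable_const :
            MeasurableSet {z : ℂ | ‖z‖ ≤ K})
        refine Finset.measurable_sum _ fun i hi => ?_
        have hi' : i ∈ Ici (m + 1) := (Finset.mem_Ico.1 hi).1
        exact (comap_measurable (η i)).mono
          (le_iSup₂ (f := fun i (_ : i ∈ Ici (m + 1)) =>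
            MeasurableSpace.comap (η i) inferInstance) i hi') le_rfl
      have hle : ∀ T : Set ℕ, ⨆ i ∈ T, MeasurableSpace.comap (η i) inferInstance ≤ ‹MeasurableSpace S› :=
        fun T => iSup₂_le fun i _ => (hη i).comap_le
      have hI : Indep (⨆ i ∈ Iio (m + 1), MeasurableSpace.comap (η i) inferInstance)
          (⨆ i ∈ Ici (m + 1), MeasurableSpace.comap (η i) inferInstance) P :=
        indep_iSup_of_disjoint (fun i => (hη i).comap_le) ((iIndepFun_iff_iIndep _ _ _).1 hind)
          (Iio_disjoint_Ici le_rfl)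
      have hprod : P.real (A ∩ D) = P.real A * P.real D := by
        have := (Indep_iff _ _ _).1 hI A D hApast hDfut
        simp only [Measure.real, this, ENNReal.toReal_mul]
      have hAm : MeasurableSet A := hle _ _ hApast
      have hDm : MeasurableSet D := hle _ _ hDfut
      have hDge : 3 / 4 ≤ P.real D := by
        have h1 := hK (m + 1) hm
        have h2 : {ω | K < ‖∑ i ∈ Finset.Ico (m + 1) n, η i ω‖} = Dᶜ := by
          ext ω; simp [hD]
        rw [h2, probReal_compl_eq_one_sub hDm] at h1
        linarith
      have hADF : A ∩ D ⊆ A ∩ F := by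
        rintro ω ⟨ha, hd⟩
        refine ⟨ha, ?_⟩
        have h1 : 2 * K < ‖∑ i ∈ Finset.range (m + 1), η i ω‖ := ha.1
        have h2 : ‖∑ i ∈ Finset.Ico (m + 1) n, η i ω‖ ≤ K := hd
        have h3 := Finset.sum_range_add_sum_Ico (fun i => η i ω) hm
        change K < ‖∑ i ∈ Finset.range n, η i ω‖
        rw [← h3]
        have := norm_sub_le (∑ i ∈ Finset.range (m + 1), η i ω + ∑ i ∈ Finset.Ico (m + 1) n, η i ω)
          (∑ i ∈ Finset.Ico (m + 1) n, η i ω)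
        rw [add_sub_cancel_right] at this
        linarith
      have hdisj : Disjoint B A := disjoint_sdiff_self_right
      rw [hsplit, union_inter_distrib_right, measureReal_union hdisj hAm,
        measureReal_union (hdisj.mono inter_subset_left inter_subset_left) (hAm.inter hFm)]
      have h4 := ih (Nat.le_of_succ_le hm)
      have h5 : P.real (A ∩ D) ≤ P.real (A ∩ F) := measureReal_mono hADF
      have h6 : 3 / 4 * P.real A ≤ P.real A * P.real D := by
        rw [mul_comm]
        exact mul_le_mul_of_nonneg_left hDge measureReal_nonneg
      linarith
  have h1 := hstep n le_rfl
  have h2 : P.real ({ω | ∃ j ≤ n, 2 * K < ‖∑ i ∈ Finset.range j, η i ω‖} ∩ F) ≤ P.real F :=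
    measureReal_mono inter_subset_right
  have h3 : P.real F ≤ 1 / 4 := by
    have := hK 0 (Nat.zero_le n)
    rwa [← Finset.range_eq_Ico] at this
  linarith

/-- An AR polynomial with a tight solution driven by i.i.d. unbounded noise has no root on the
unit circle. -/
theorem not_uniformlyTight_of_unit_root [IsProbabilityMeasure P] {ξ : ℤ → S → ℝ}
    (hξ : ∀ i, Measurable (ξ i)) (hind : iIndepFun ξ P)
    {q : ℝ → ℝ} (hq : ∀ i y, P.real {ω | y < |ξ i ω|} = q y) (hq0 : ∀ y, 0 < q y)
    {V : ℤ → S → ℂ} {r : ℂ} (hr : ‖r‖ = 1)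
    (hV : ∀ i ω, V (i - 1) ω - r * V i ω = ξ i ω) : ¬ UniformlyTight P V := by
  intro ht
  obtain ⟨K₀, hK₀⟩ := ht (1 / 8) (by norm_num)
  set K := 2 * |K₀| with hK
  set η : ℕ → S → ℂ := fun m ω => -r ^ m * (ξ (m + 1) ω : ℂ) with hη
  have hηm : ∀ m, Measurable (η m) := fun m => by
    have := hξ (m + 1)
    fun_prop
  have hinj : Function.Injective fun m : ℕ => (m : ℤ) + 1 := fun a b h => by
    simpa using h
  have hηind : iIndepFun η P :=
    (hind.precomp hinj).comp (fun m (x : ℝ) => -r ^ m * (x : ℂ)) (fun m => by fun_prop)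
  have hnorm : ∀ m ω, ‖η m ω‖ = |ξ (m + 1) ω| := fun m ω => by
    simp [hη, hr]
  have hw : ∀ m n : ℕ, m ≤ n → ∀ ω, ∑ i ∈ Finset.Ico m n, η i ω = r ^ n * V n ω - r ^ m * V m ω := by
    intro m n hmn ω
    induction n, hmn using Nat.le_induction with
    | base => simp
    | succ n hmn ih =>
      rw [Finset.sum_Ico_succ_top hmn, ih]
      have := hV (n + 1) ω
      rw [add_sub_cancel_right] at this
      simp only [hη, ← this]
      push_cast
      ring
  have hbound : ∀ n : ℕ, ∀ m ≤ n, P.real {ω | K < ‖∑ i ∈ Finset.Ico m n, η i ω‖} ≤ 1 / 4 := by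
    intro n m hmn
    have hsub : {ω | K < ‖∑ i ∈ Finset.Ico m n, η i ω‖} ⊆
        {ω | K₀ < ‖V n ω‖} ∪ {ω | K₀ < ‖V m ω‖} := by
      intro ω hω
      by_contra hno
      simp only [mem_union, mem_ofPred_eq, not_or, not_lt] at hω hno
      rw [hw m n hmn] at hω
      have := norm_sub_le (r ^ n * V n ω) (r ^ m * V m ω)
      simp only [norm_mul, norm_pow, hr, one_pow, one_mul] at this
      linarith [le_abs_self K₀]
    have := (measureReal_mono hsub).trans (measureReal_union_le (μ := P) _ _)
    linarith [hK₀ n, hK₀ m]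
  have hmax : ∀ n : ℕ, 1 / 2 ≤ (1 - q (4 * K)) ^ n := by
    intro n
    have h1 := measureReal_exists_partial_sum_gt_le hηm hηind (K := K) (by positivity) (hbound n)
    have hsub : {ω | ∃ m ≤ n, 2 * K < ‖∑ i ∈ Finset.range m, η i ω‖}ᶜ ⊆
        ⋂ m ∈ Finset.range n, η m ⁻¹' {z | ‖z‖ ≤ 4 * K} := by
      intro ω hω
      simp only [mem_compl_iff, mem_ofPred_eq, not_exists, not_and, not_lt] at hω
      simp only [mem_iInter, mem_preimage, mem_ofPred_eq]
      intro m hm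
      have hmn := Finset.mem_range.1 hm
      have a1 := hω m hmn.le
      have a2 := hω (m + 1) hmn
      have a3 := norm_sub_le (∑ i ∈ Finset.range (m + 1), η i ω) (∑ i ∈ Finset.range m, η i ω)
      rw [Finset.sum_range_succ, add_sub_cancel_left] at a3
      rw [Finset.sum_range_succ] at a2
      linarith
    have hmeas : MeasurableSet {ω | ∃ m ≤ n, 2 * K < ‖∑ i ∈ Finset.range m, η i ω‖} := by
      have he : {ω | ∃ m ≤ n, 2 * K < ‖∑ i ∈ Finset.range m, η i ω‖} =
          ⋃ m, ⋃ (_ : m ≤ n), {ω | 2 * K < ‖∑ i ∈ Finset.range m, η i ω‖} := by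
        ext ω
        simp
      rw [he]
      refine MeasurableSet.iUnion fun j => MeasurableSet.iUnion fun _ => ?_
      exact measurableSet_lt measurable_const (Finset.measurable_sum _ fun i _ => hηm i).norm
    have h2 : P.real {ω | ∃ m ≤ n, 2 * K < ‖∑ i ∈ Finset.range m, η i ω‖}ᶜ ≤ _ :=
      measureReal_mono hsub
    rw [probReal_compl_eq_one_sub hmeas] at h2
    have hball : MeasurableSet {z : ℂ | ‖z‖ ≤ 4 * K} :=
      measurableSet_le measurable_norm measurable_const
    have h3 : P.real (⋂ m ∈ Finset.range n, η m ⁻¹' {z | ‖z‖ ≤ 4 * K}) = (1 - q (4 * K)) ^ n := by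
      rw [Measure.real, hηind.measure_inter_preimage_eq_mul (Finset.range n)
        (sets := fun _ => {z : ℂ | ‖z‖ ≤ 4 * K}) (fun _ _ => hball), ENNReal.toReal_prod]
      have h4 : ∀ m : ℕ, (P (η m ⁻¹' {z | ‖z‖ ≤ 4 * K})).toReal = 1 - q (4 * K) := by
        intro m
        have he : η m ⁻¹' {z | ‖z‖ ≤ 4 * K} = {ω | 4 * K < |ξ (m + 1) ω|}ᶜ := by
          ext ω
          simp [hnorm]
        rw [he]
        change P.real _ = _
        have hm : MeasurableSet {ω | 4 * K < |ξ (m + 1) ω|} :=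
          measurableSet_lt measurable_const (hξ _).abs
        rw [probReal_compl_eq_one_sub hm, hq]
      rw [Finset.prod_congr rfl fun m _ => h4 m, Finset.prod_const, Finset.card_range]
    linarith
  have hq1 : q (4 * K) ≤ 1 := by
    rw [← hq 0]
    exact measureReal_le_one
  have hlim := tendsto_pow_atTop_nhds_zero_of_lt_one (r := 1 - q (4 * K)) (by linarith)
    (by linarith [hq0 (4 * K)])
  have := ge_of_tendsto' hlim hmax
  norm_num at this

end RandomWalk

/-- The marginal tails of a stationary AR process are negligible, after a large dilation, relative
to the regularly varying tail of its innovations. -/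
theorem ParetoTail.autoregression_tail_le {S : Type*} [MeasurableSpace S] {P : Measure S}
    [IsProbabilityMeasure P] {p : ℕ} {φc : Fin p → ℝ} {X ξ : ℤ → S → ℝ}
    (hXmeas : ∀ i, Measurable (X i)) (hξmeas : ∀ i, Measurable (ξ i))
    (hmodel : ∀ (i : ℤ) ω, X i ω = ∑ j : Fin p, φc j * X (i - ((j : ℕ) + 1)) ω + ξ i ω)
    (hchar : ∀ z : ℂ, ‖z‖ < 1 →
      (1 : ℂ) - ∑ j : Fin p, (φc j : ℂ) * z ^ ((j : ℕ) + 1) ≠ 0)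
    (hX : ∀ i y, P.real {ω | y < |X i ω|} = P.real {ω | y < |X 0 ω|})
    (hind : iIndepFun ξ P) {μ : Measure ℝ} [IsProbabilityMeasure μ] {α : ℝ} (hα : 0 < α)
    {l : ℝ → ℝ} (hμ : ParetoTail μ α l) (hξ : ∀ i y, P.real {ω | y < |ξ i ω|} = tailDF μ y)
    {ε : ℝ} (hε : 0 < ε) :
    ∃ M > 0, ∃ y₀, ∀ i, ∀ y ≥ y₀, P.real {ω | M * y < |X i ω|} ≤ ε * tailDF μ y := by
  set U : ℤ → S → ℂ := fun i ω => (X i ω : ℂ) with hU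
  have hUn : ∀ i ω, ‖U i ω‖ = |X i ω| := fun i ω => by simp [hU]
  have htight : UniformlyTight P U := by
    intro ε hε
    have hE : ⋂ n : ℕ, {ω | (n : ℝ) < |X 0 ω|} = ∅ := by
      rw [eq_empty_iff_forall_notMem]
      intro ω hω
      obtain ⟨n, hn⟩ := exists_nat_ge |X 0 ω|
      exact absurd (mem_iInter.1 hω n) (not_lt.2 hn)
    have h := tendsto_measure_iInter_atTop (μ := P) (s := fun n : ℕ => {ω | (n : ℝ) < |X 0 ω|})
      (fun n => (measurableSet_lt measurable_const (hXmeas 0).abs).nullMeasurableSet)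
      (fun n m hnm ω hω => lt_of_le_of_lt (show (n : ℝ) ≤ m from Nat.cast_le.2 hnm) hω) ⟨0, measure_ne_top _ _⟩
    rw [hE, measure_empty] at h
    have h' := (ENNReal.tendsto_toReal ENNReal.zero_ne_top).comp h
    obtain ⟨n, hn⟩ := (h'.eventually_le_const (show (0 : ENNReal).toReal < ε by simpa using hε)).exists
    refine ⟨n, fun i => ?_⟩
    simp only [hUn, hX i]
    exact hn
  set Q : Polynomial ℂ :=
    1 - ∑ j : Fin p, Polynomial.C (φc j : ℂ) * Polynomial.X ^ ((j : ℕ) + 1) with hQ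
  have hQeval : ∀ z, Q.eval z = 1 - ∑ j : Fin p, (φc j : ℂ) * z ^ ((j : ℕ) + 1) := fun z => by
    simp [hQ, Polynomial.eval_finsetSum]
  have hQ0 : Q ≠ 0 := by
    intro h0
    have := hchar 0 (by simp)
    rw [← hQeval, h0] at this
    simp at this
  have hQU : Polynomial.aeval (backshift S) Q U = fun i ω => (ξ i ω : ℂ) := by
    funext i ω
    have h1 : Polynomial.aeval (backshift S) Q U i ω =
        U i ω - ∑ j : Fin p, (φc j : ℂ) * U (i - (((j : ℕ) + 1 : ℕ) : ℤ)) ω := by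
      simp only [hQ, map_sub, map_one, map_sum, map_mul, Polynomial.aeval_C, map_pow,
        Polynomial.aeval_X, LinearMap.sub_apply, Module.End.one_apply, LinearMap.sum_apply,
        Module.End.mul_apply, Module.algebraMap_end_apply, Pi.sub_apply, Finset.sum_apply,
        Pi.smul_apply, smul_eq_mul, backshift_pow_apply]
    rw [h1]
    simp only [hU, hmodel i ω]
    push_cast
    ring
  have hroot : ∀ r, Q.IsRoot r → 1 < ‖r‖ := by
    intro r hr
    have hge : 1 ≤ ‖r‖ := by
      by_contra hlt
      exact hchar r (not_le.1 hlt) (by rw [← hQeval]; exact hr)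
    refine lt_of_le_of_ne hge fun heq => ?_
    obtain ⟨R, hR⟩ := Polynomial.dvd_iff_isRoot.2 hr
    refine not_uniformlyTight_of_unit_root hξmeas hind hξ hμ.pos heq.symm
      (V := Polynomial.aeval (backshift S) R U) ?_ (htight.aeval R)
    intro i ω
    rw [← congrFun (congrFun hQU i) ω, hR]
    simp [Module.End.mul_apply, backshift_apply, Module.algebraMap_end_apply]
  have hgeo : ∀ τ > 1, ∃ θ, 0 < θ ∧ θ < 1 ∧ ∃ x₀, 0 < x₀ ∧ ∀ x ≥ x₀, ∀ j : ℕ,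
      tailDF μ (τ ^ j * x) ≤ θ ^ j * tailDF μ x := fun τ hτ => hμ.exists_geometric_bound hα hτ
  have hdom : TailDominated P (tailDF μ) U := by
    refine TailDominated.of_aeval (tailDF_nonneg μ) hgeo htight hQ0 hroot ?_
    rw [hQU]
    refine ⟨1, one_pos, 1, zero_le_one, 0, fun i y _ => ?_⟩
    simp only [one_mul, Complex.norm_real, Real.norm_eq_abs, hξ, le_refl]
  obtain ⟨L, hL, C, hC, y₀, hb⟩ := hdom
  obtain ⟨θ, hθ0, hθ1, x₀, hx₀, hθ⟩ := hgeo 2 one_lt_two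
  obtain ⟨j, hj⟩ := exists_pow_lt_of_lt_one (show 0 < ε / (C + 1) by positivity) hθ1
  refine ⟨L * 2 ^ j, by positivity, max x₀ y₀, fun i y hy => ?_⟩
  have hyx : x₀ ≤ y := (le_max_left _ _).trans hy
  have hy0 : 0 < y := hx₀.trans_le hyx
  have hyy : y₀ ≤ 2 ^ j * y := ((le_max_right _ _).trans hy).trans
    (le_mul_of_one_le_left hy0.le (one_le_pow₀ one_le_two))
  have h1 := hb i _ hyy
  simp only [hUn, ← mul_assoc] at h1
  have h2 := mul_le_mul_of_nonneg_left (hθ y hyx j) hC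
  rw [lt_div_iff₀ (by positivity)] at hj
  have h3 : C * θ ^ j ≤ ε := by
    have := pow_pos hθ0 j
    nlinarith
  calc P.real {ω | L * 2 ^ j * y < |X i ω|} ≤ C * tailDF μ (2 ^ j * y) := h1
    _ ≤ C * θ ^ j * tailDF μ y := by linarith
    _ ≤ ε * tailDF μ y := mul_le_mul_of_nonneg_right h3 (tailDF_nonneg _ _)

/-- Chernoff bound for the number of independent variables falling in a set. -/
theorem measureReal_card_ge_le {S ι : Type*} [MeasurableSpace S] {P : Measure S}
    [IsProbabilityMeasure P] {Z : ι → S → ℝ} (hZ : ∀ i, Measurable (Z i)) (hind : iIndepFun Z P)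
    {A : Set ℝ} (hA : MeasurableSet A) {q : ℝ} (hq : ∀ i, P.real (Z i ⁻¹' A) ≤ q)
    (s : Finset ι) (t : ℝ) :
    P.real {ω | t ≤ ∑ i ∈ s, A.indicator (1 : ℝ → ℝ) (Z i ω)} ≤
      Real.exp (2 * (s.card * q) - t) := by
  have hAm : Measurable (A.indicator (1 : ℝ → ℝ)) := measurable_one.indicator hA
  set Y : ι → S → ℝ := fun i ω => A.indicator (1 : ℝ → ℝ) (Z i ω) with hY
  have hYm : ∀ i, Measurable (Y i) := fun i => hAm.comp (hZ i)
  have hYind : iIndepFun Y P := hind.comp (fun _ => A.indicator (1 : ℝ → ℝ)) fun _ => hAm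
  have hY1 : ∀ i ω, Y i ω ≤ 1 := fun i ω => by
    simp only [hY, indicator]
    split_ifs <;> simp
  have hmgf : ∀ i, mgf (Y i) P 1 ≤ Real.exp (2 * q) := by
    intro i
    have he : ∀ ω, Real.exp (1 * Y i ω) =
        1 + (Real.exp 1 - 1) * (Z i ⁻¹' A).indicator (1 : S → ℝ) ω := by
      intro ω
      by_cases h : Z i ω ∈ A <;> simp [hY, h, indicator]
    have hexpint : Integrable ((Z i ⁻¹' A).indicator (1 : S → ℝ)) P :=
      (integrable_const (1 : ℝ)).indicator (hZ i hA)
    have hm : mgf (Y i) P 1 = 1 + (Real.exp 1 - 1) * P.real (Z i ⁻¹' A) := by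
      rw [mgf, integral_congr_ae (ae_of_all _ he), integral_add (integrable_const _)
        (hexpint.const_mul _), integral_const_mul, integral_indicator_one (hZ i hA)]
      simp
    rw [hm]
    have h1 := Real.exp_one_lt_d9
    have h2 : 0 ≤ P.real (Z i ⁻¹' A) := measureReal_nonneg
    have h3 := Real.add_one_le_exp (2 * q)
    nlinarith [hq i]
  have hexpint : Integrable (fun ω => Real.exp (1 * (∑ i ∈ s, Y i) ω)) P := by
    refine Integrable.of_bound (C := Real.exp s.card) ?_ (ae_of_all _ fun ω => ?_)
    · simp only [Finset.sum_apply]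
      exact (Real.measurable_exp.comp
        ((Finset.measurable_sum s fun i _ => hYm i).const_mul 1)).aestronglyMeasurable
    · rw [Real.norm_eq_abs, abs_of_pos (Real.exp_pos _), one_mul, Finset.sum_apply]
      refine Real.exp_le_exp.2 ((Finset.sum_le_sum fun i _ => hY1 i ω).trans ?_)
      simp
  have h := measure_ge_le_exp_mul_mgf (μ := P) (X := ∑ i ∈ s, Y i) t zero_le_one hexpint
  rw [hYind.mgf_sum hYm] at h
  simp only [Finset.sum_apply] at h
  refine h.trans ?_
  calc Real.exp (-1 * t) * ∏ i ∈ s, mgf (Y i) P 1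
      ≤ Real.exp (-1 * t) * ∏ _i ∈ s, Real.exp (2 * q) :=
        mul_le_mul_of_nonneg_left
          (Finset.prod_le_prod (fun i _ => mgf_nonneg) fun i _ => hmgf i) (Real.exp_pos _).le
    _ = Real.exp (2 * (s.card * q) - t) := by
        rw [Finset.prod_const, ← Real.exp_nat_mul, ← Real.exp_add]
        ring_nf

/-- Markov's inequality for the number of occurring events. -/
theorem measureReal_sum_indicator_ge_le {S ι : Type*} [MeasurableSpace S] {P : Measure S}
    [IsProbabilityMeasure P] {E : ι → Set S} (hE : ∀ i, MeasurableSet (E i)) {q : ℝ}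
    (hq : ∀ i, P.real (E i) ≤ q) (s : Finset ι) {t : ℝ} (ht : 0 < t) :
    P.real {ω | t ≤ ∑ i ∈ s, (E i).indicator (1 : S → ℝ) ω} ≤ s.card * q / t := by
  have hexpint : ∀ i ∈ s, Integrable ((E i).indicator (1 : S → ℝ)) P := fun i _ =>
    (integrable_const (1 : ℝ)).indicator (hE i)
  have h := mul_meas_ge_le_integral_of_nonneg (μ := P)
    (f := fun ω => ∑ i ∈ s, (E i).indicator (1 : S → ℝ) ω)
    (ae_of_all _ fun ω => Finset.sum_nonneg fun i _ =>
      indicator_nonneg (fun _ _ => zero_le_one) ω) (integrable_finsetSum s hexpint) t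
  rw [integral_finsetSum s hexpint] at h
  simp only [integral_indicator_one (hE _)] at h
  rw [le_div_iff₀ ht, mul_comm]
  refine h.trans ((Finset.sum_le_sum fun i _ => hq i).trans ?_)
  simp

/-- Exceedances of a level by perturbed variables are controlled by the number of large
perturbations and the number of variables in one cell of a fixed grid. -/
theorem exists_cell_sum_abs_sub_le {c dd e b h x : ℝ} (he : 0 < e) (hec : e ≤ c / 2) (hb : 0 < b)
    (hh : h ≤ e * b) (hx : x ∈ Icc c dd) (s : Finset ℕ) (Z Z' : ℕ → ℝ) (w : ℕ → ℝ)
    (hw0 : ∀ i, 0 ≤ w i) (hw : ∀ i, 1 ≤ w i ∨ |Z' i - Z i| ≤ h) :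
    ∃ m ∈ Finset.range (⌊dd / e⌋₊ + 1),
      ∑ i ∈ s, |(if x * b < Z i then (1 : ℝ) else 0) - (if x * b < Z' i then (1 : ℝ) else 0)| ≤
      ∑ i ∈ s, w i + ∑ i ∈ s,
        (Ioc ((c / 2 + m * e) * b) ((c / 2 + m * e + 3 * e) * b)).indicator (1 : ℝ → ℝ) (Z i) := by
  have hy0 : 0 ≤ (x - e - c / 2) / e := div_nonneg (by linarith [hx.1]) he.le
  refine ⟨⌊(x - e - c / 2) / e⌋₊, ?_, ?_⟩
  · rw [Finset.mem_range, Nat.lt_succ_iff]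
    refine Nat.floor_le_floor (div_le_div_of_nonneg_right ?_ he.le)
    linarith [hx.2]
  · set m := ⌊(x - e - c / 2) / e⌋₊
    have h1 := Nat.floor_le hy0
    have h2 := Nat.lt_floor_add_one ((x - e - c / 2) / e)
    rw [le_div_iff₀ he] at h1
    rw [div_lt_iff₀ he] at h2
    have h3 : (c / 2 + m * e) * b ≤ (x - e) * b := mul_le_mul_of_nonneg_right (by linarith) hb.le
    have h4 : (x + e) * b ≤ (c / 2 + m * e + 3 * e) * b :=
      mul_le_mul_of_nonneg_right (by linarith) hb.le
    rw [← Finset.sum_add_distrib]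
    refine Finset.sum_le_sum fun i _ => ?_
    have hi0 : 0 ≤ (Ioc ((c / 2 + m * e) * b) ((c / 2 + m * e + 3 * e) * b)).indicator
        (1 : ℝ → ℝ) (Z i) := indicator_nonneg (fun _ _ => zero_le_one) _
    rcases hw i with hwi | hwi
    · refine le_trans ?_ (le_add_of_le_of_nonneg hwi hi0)
      split_ifs <;> norm_num
    · by_cases hmem : Z i ∈ Ioc ((c / 2 + m * e) * b) ((c / 2 + m * e + 3 * e) * b)
      · rw [indicator_of_mem hmem, Pi.one_apply]
        refine le_trans ?_ (le_add_of_nonneg_left (hw0 i))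
        split_ifs <;> norm_num
      · rw [indicator_of_notMem hmem, add_zero]
        have h5 := abs_le.1 hwi
        split_ifs with ha hb' hb'
        · simpa using hw0 i
        · exact absurd ⟨by linarith, by linarith⟩ hmem
        · exact absurd ⟨by linarith, by linarith⟩ hmem
        · simpa using hw0 i

/-- A union bound for the supremum, over thresholds, of the number of discrepancies between the
exceedances of independent variables and those of their perturbations. -/
theorem measureReal_iSup_sum_gt_le {S : Type*} [MeasurableSpace S] {P : Measure S}
    [IsProbabilityMeasure P] {Z Z' : ℕ → S → ℝ} (hZ : ∀ i, Measurable (Z i)) (hind : iIndepFun Z P)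
    {B : Set S} {W : ℕ → Set S} (hW : ∀ i, MeasurableSet (W i)) {c dd e b h q r t : ℝ}
    (hcd : c ≤ dd) (he : 0 < e) (hec : e ≤ c / 2) (hb : 0 < b) (hh : h ≤ e * b)
    (hZ' : ∀ ω ∉ B, ∀ i, ω ∉ W i → |Z' i ω - Z i ω| ≤ h) (hq : ∀ i, P.real (W i) ≤ q)
    (hr : ∀ m ≤ ⌊dd / e⌋₊, ∀ i,
      P.real (Z i ⁻¹' Ioc ((c / 2 + m * e) * b) ((c / 2 + m * e + 3 * e) * b)) ≤ r)
    (s : Finset ℕ) (ht : 0 < t) :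
    P.real {ω | 2 * t < ⨆ x : Icc c dd, ∑ i ∈ s,
      |(if (x : ℝ) * b < Z i ω then (1 : ℝ) else 0) -
        (if (x : ℝ) * b < Z' i ω then (1 : ℝ) else 0)|} ≤
      P.real B + s.card * q / t + (dd / e + 1) * Real.exp (2 * (s.card * r) - t) := by
  set A : ℕ → Set ℝ := fun m => Ioc ((c / 2 + m * e) * b) ((c / 2 + m * e + 3 * e) * b) with hA
  set N := Finset.range (⌊dd / e⌋₊ + 1) with hN
  set E₁ : Set S := {ω | t ≤ ∑ i ∈ s, (W i).indicator (1 : S → ℝ) ω}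
  set E₂ : ℕ → Set S := fun m => {ω | t ≤ ∑ i ∈ s, (A m).indicator (1 : ℝ → ℝ) (Z i ω)}
  have hc : 0 < c := by linarith
  have hsub : {ω | 2 * t < ⨆ x : Icc c dd, ∑ i ∈ s,
      |(if (x : ℝ) * b < Z i ω then (1 : ℝ) else 0) -
        (if (x : ℝ) * b < Z' i ω then (1 : ℝ) else 0)|} ⊆ (B ∪ E₁) ∪ ⋃ m ∈ N, E₂ m := by
    intro ω hω
    by_contra hn
    simp only [mem_union, mem_iUnion, not_or, not_exists] at hn
    obtain ⟨⟨hB, h1⟩, h2⟩ := hn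
    have : Nonempty (Icc c dd) := ⟨⟨c, le_rfl, hcd⟩⟩
    refine lt_irrefl (2 * t) (lt_of_lt_of_le hω (ciSup_le fun x => ?_))
    obtain ⟨m, hm, hle⟩ := exists_cell_sum_abs_sub_le he hec hb hh x.2 s (fun i => Z i ω)
      (fun i => Z' i ω) (fun i => (W i).indicator (1 : S → ℝ) ω)
      (fun i => indicator_nonneg (fun _ _ => zero_le_one) ω) fun i => by
        by_cases hi : ω ∈ W i
        · left
          simp [hi]
        · exact Or.inr (hZ' ω hB i hi)
    have h1' : _ < t := not_le.1 fun h => h1 h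
    have h2' : _ < t := not_le.1 fun h => h2 m hm h
    linarith
  have hE₁ : P.real E₁ ≤ s.card * q / t := measureReal_sum_indicator_ge_le hW hq s ht
  have hE₂ : P.real (⋃ m ∈ N, E₂ m) ≤ (dd / e + 1) * Real.exp (2 * (s.card * r) - t) := by
    refine (measureReal_biUnion_finset_le N E₂).trans ?_
    refine (Finset.sum_le_card_nsmul N _ (Real.exp (2 * (s.card * r) - t)) fun m hm =>
      measureReal_card_ge_le hZ hind measurableSet_Ioc
        (hr m (Nat.lt_succ_iff.1 (Finset.mem_range.1 hm))) s t).trans ?_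
    rw [nsmul_eq_mul, hN, Finset.card_range, Nat.cast_add_one]
    refine mul_le_mul_of_nonneg_right ?_ (Real.exp_pos _).le
    linarith [Nat.floor_le (div_nonneg (hc.le.trans hcd) he.le)]
  have h3 := (measureReal_mono (μ := P) hsub).trans (measureReal_union_le _ _)
  have h4 := measureReal_union_le (μ := P) B E₁
  linarith

theorem tailFraction_tendsto_div {k : ℕ → ℕ} (hk : TailFraction k) :
    Tendsto (fun n : ℕ => (n : ℝ) / k n) atTop atTop := by
  have hpos : ∀ᶠ n : ℕ in atTop, (k n : ℝ) / n ∈ Ioi (0 : ℝ) := by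
    filter_upwards [hk.1.eventually_gt_atTop 0, eventually_gt_atTop 0] with n hkn hn
    exact div_pos hkn (Nat.cast_pos.2 hn)
  refine (tendsto_nhdsWithin_iff.2 ⟨hk.2, hpos⟩).inv_tendsto_nhdsGT_zero.congr fun n => ?_
  rw [Pi.inv_apply, inv_div]

theorem tailFraction_tendsto_div_sqrt {k : ℕ → ℕ} (hk : TailFraction k) :
    Tendsto (fun n : ℕ => (n : ℝ) / Real.sqrt (k n)) atTop atTop := by
  refine tendsto_atTop_mono' _ ?_ (tailFraction_tendsto_div hk)
  filter_upwards [hk.1.eventually_ge_atTop 1] with n hn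
  have h1 : 0 < Real.sqrt (k n) := Real.sqrt_pos.2 (by linarith)
  refine div_le_div_of_nonneg_left n.cast_nonneg h1 ?_
  exact Real.sqrt_le_left (by linarith) |>.2 (by nlinarith)

/-- Off the event that a lagged value is large, the absolute residual is close to the absolute
innovation. -/
theorem abs_Zhat_sub_le {S : Type*} {p : ℕ} {φc : Fin p → ℝ} {X ξ : ℤ → S → ℝ}
    (hmodel : ∀ (i : ℤ) ω, X i ω = ∑ j : Fin p, φc j * X (i - ((j : ℕ) + 1)) ω + ξ i ω)
    {φh : S → Fin p → ℝ} {i : ℕ} {ω : S} {A L : ℝ}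
    (hA : ‖(fun j => φh ω j - φc j : Fin p → ℝ)‖ ≤ A)
    (hL : ∀ j : Fin p, |X ((i : ℤ) - ((j : ℕ) + 1)) ω| ≤ L) :
    |Zhat p X φh i ω - (|ξ i ω|)| ≤ p * (A * L) := by
  refine (abs_abs_sub_abs_le_abs_sub _ _).trans ?_
  have h : residual p X φh i ω - ξ i ω =
      -∑ j : Fin p, (φh ω j - φc j) * X ((i : ℤ) - ((j : ℕ) + 1)) ω := by
    simp only [residual, hmodel (i : ℤ) ω, sub_mul, Finset.sum_sub_distrib]
    ring
  rw [h, abs_neg]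
  refine (Finset.abs_sum_le_sum_abs _ _).trans ?_
  refine (Finset.sum_le_card_nsmul _ _ (A * L) fun j _ => ?_).trans (by simp)
  rw [abs_mul]
  have h1 := (norm_le_pi_norm (fun j => φh ω j - φc j : Fin p → ℝ) j).trans hA
  exact mul_le_mul h1 (hL j) (abs_nonneg _) ((norm_nonneg _).trans h1)

theorem measureReal_preimage_Ioc_eq {S : Type*} [MeasurableSpace S] {P : Measure S}
    [IsProbabilityMeasure P] {μ : Measure ℝ} {Z : S → ℝ} (hZ : Measurable Z)
    (hμ : ∀ y, P.real {ω | y < Z ω} = tailDF μ y) {x y : ℝ} (hxy : x ≤ y) :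
    P.real (Z ⁻¹' Ioc x y) = tailDF μ x - tailDF μ y := by
  have h : Z ⁻¹' Ioc x y = {ω | x < Z ω} \ {ω | y < Z ω} := by
    ext ω
    simp
  have hsub : {ω | y < Z ω} ⊆ {ω | x < Z ω} := fun ω hω => lt_of_le_of_lt hxy hω
  rw [h, measureReal_sdiff hsub (measurableSet_lt measurable_const hZ), hμ, hμ]

theorem IsStationaryZ.measureReal_abs_gt {X : ℤ → Ω → ℝ} (h : IsStationaryZ X)
    (hX : ∀ i, Measurable (X i)) (i : ℤ) (y : ℝ) :
    (ℙ : Measure Ω).real {ω | y < |X i ω|} = (ℙ : Measure Ω).real {ω | y < |X 0 ω|} := by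
  have hm : MeasurableSet {f : ℤ → ℝ | y < |f 0|} :=
    measurableSet_lt measurable_const (measurable_pi_apply 0).abs
  have h' := DFunLike.congr_fun (h i) {f : ℤ → ℝ | y < |f 0|}
  rw [Measure.map_apply (measurable_pi_lambda _ fun j => hX _) hm,
    Measure.map_apply (measurable_pi_lambda _ fun j => hX _) hm] at h'
  simpa [measureReal_def] using congrArg ENNReal.toReal h'

theorem measureReal_abs_gt_eq_tailDF {S : Type*} [MeasurableSpace S] {P : Measure S}
    {ξ : ℤ → S → ℝ} (hξ : ∀ i, Measurable (ξ i)) {i j : ℤ}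
    (hident : Measure.map (ξ i) P = Measure.map (ξ j) P) (y : ℝ) :
    P.real {ω | y < |ξ i ω|} = tailDF (Measure.map (fun ω => |ξ j ω|) P) y := by
  have hm : MeasurableSet {x : ℝ | y < |x|} := measurableSet_lt measurable_const measurable_id.abs
  have h : ∀ i, P {ω | y < |ξ i ω|} = Measure.map (ξ i) P {x | y < |x|} := fun i =>
    (Measure.map_apply (hξ i) hm).symm
  rw [tailDF, Measure.map_apply (hξ j).abs measurableSet_Ioi, measureReal_def, h, hident, ← h]
  rfl

/-- A polynomially growing number of cells is beaten by the Chernoff rate. -/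
theorem tendsto_add_one_mul_exp_neg {a b : ℝ} (hb : 0 < b) :
    Tendsto (fun x : ℝ => (a * x + 1) * Real.exp (-b * x)) atTop (nhds 0) := by
  have h1 := (tendsto_rpow_mul_exp_neg_mul_atTop_nhds_zero 1 b hb).const_mul a
  have h0 := tendsto_rpow_mul_exp_neg_mul_atTop_nhds_zero 0 b hb
  have h := h1.add h0
  simp only [mul_zero, add_zero, Real.rpow_one, Real.rpow_zero] at h
  exact h.congr fun x => by ring

set_option maxHeartbeats 400000 in
/-- Lemma 7 of Kim–Lee (2009): under (B1)–(B4), for every `0 < c < d`,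
`k^{-1/2} sup_{x∈[c,d]} Σ_{i=1}^n |1{Z_i > x b*(n/k)} - 1{Ẑ_i > x b*(n/k)}| = o_P(1)`. -/
theorem residual_indicator_comparison
    {Ω : Type*} [MeasureSpace Ω] [IsProbabilityMeasure (ℙ : Measure Ω)]
    (p : ℕ) (φc : Fin p → ℝ) (X ξ : ℤ → Ω → ℝ)
    (hXmeas : ∀ i, Measurable (X i)) (hξmeas : ∀ i, Measurable (ξ i))
    (hmodel : ∀ (i : ℤ) ω, X i ω = ∑ j : Fin p, φc j * X (i - ((j : ℕ) + 1)) ω + ξ i ω)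
    (hchar : ∀ z : ℂ, ‖z‖ < 1 →
      (1 : ℂ) - ∑ j : Fin p, (φc j : ℂ) * z ^ ((j : ℕ) + 1) ≠ 0)
    (hstat : IsStationaryZ X)
    (hindep : iIndepFun (m := fun _ : ℤ => Real.measurableSpace) ξ (ℙ : Measure Ω))
    (hident : ∀ i : ℤ, Measure.map (ξ i) (ℙ : Measure Ω) = Measure.map (ξ 1) (ℙ : Measure Ω))
    (α : ℝ) (hα : 0 < α) (lstar : ℝ → ℝ)
    (hB1 : ParetoTail (Measure.map (fun ω => |ξ 1 ω|) (ℙ : Measure Ω)) α lstar)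
    (g : ℝ → ℝ) (Kκ γ : ℝ) (hB2 : SecondOrderRV lstar g Kκ γ)
    (k : ℕ → ℕ) (hk : TailFraction k)
    (hB3 : Tendsto (fun n : ℕ => Real.sqrt (k n) * g ((quantileB (Measure.map (fun ω => |ξ 1 ω|) (ℙ : Measure Ω))) ((n : ℝ) / k n)))
      atTop (nhds 0))
    (φhat : ℕ → Ω → Fin p → ℝ) (hφhat : ∀ n, Measurable (φhat n))
    (d : ℕ → ℝ) (hd : Tendsto d atTop atTop)
    (hdb : Tendsto (fun n : ℕ =>
        (Real.sqrt (k n) * (quantileB (Measure.map (fun ω => |ξ 1 ω|) (ℙ : Measure Ω))) ((n : ℝ) / Real.sqrt (k n)) / (quantileB (Measure.map (fun ω => |ξ 1 ω|) (ℙ : Measure Ω))) ((n : ℝ) / k n)) / d n)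
      atTop (nhds 0))
    (hB4 : BddInProb (fun n ω => d n * ‖(fun j => φhat n ω j - φc j : Fin p → ℝ)‖)) :
    ∀ c dd : ℝ, 0 < c → c < dd →
      TendstoInMeasure (ℙ : Measure Ω)
        (fun n ω => (Real.sqrt (k n))⁻¹ *
          ⨆ x : Icc c dd, ∑ i ∈ Finset.Icc 1 n,
            |(if (x : ℝ) * (quantileB (Measure.map (fun ω => |ξ 1 ω|) (ℙ : Measure Ω))) ((n : ℝ) / k n) < |ξ (i : ℤ) ω| then (1 : ℝ) else 0)
              - (if (x : ℝ) * (quantileB (Measure.map (fun ω => |ξ 1 ω|) (ℙ : Measure Ω))) ((n : ℝ) / k n) < Zhat p X (φhat n) i ω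
                  then (1 : ℝ) else 0)|)
        atTop 0 := by
  intro c dd hc hcd
  set ν := Measure.map (fun ω => |ξ 1 ω|) (ℙ : Measure Ω) with hν
  have : IsProbabilityMeasure ν :=
    Measure.isProbabilityMeasure_map (hξmeas 1).abs.aemeasurable
  have htail : ∀ i y, (ℙ : Measure Ω).real {ω | y < |ξ i ω|} = tailDF ν y := fun i y =>
    measureReal_abs_gt_eq_tailDF hξmeas (hident i) y
  set b : ℕ → ℝ := fun n => quantileB ν ((n : ℝ) / k n) with hbdef
  set b' : ℕ → ℝ := fun n => quantileB ν ((n : ℝ) / Real.sqrt (k n)) with hb'def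
  have hnk := tailFraction_tendsto_div hk
  have hnk' := tailFraction_tendsto_div_sqrt hk
  have hb : Tendsto b atTop atTop := hB1.tendsto_quantileB.comp hnk
  have hb' : Tendsto b' atTop atTop := hB1.tendsto_quantileB.comp hnk'
  have hsk : Tendsto (fun n => Real.sqrt (k n)) atTop atTop := Real.tendsto_sqrt_atTop.comp hk.1
  have hZmeas : ∀ i : ℕ, Measurable fun ω => |ξ (i : ℤ) ω| := fun i => (hξmeas i).abs
  have hZind : iIndepFun (fun (i : ℕ) ω => |ξ (i : ℤ) ω|) (ℙ : Measure Ω) :=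
    (hindep.precomp (g := fun i : ℕ => (i : ℤ)) Nat.cast_injective).comp (fun _ x => |x|)
      fun _ => measurable_id.abs
  rw [tendstoInMeasure_iff_measureReal_norm]
  intro ε hε
  refine tendsto_order.2 ⟨fun a ha => Eventually.of_forall fun n =>
    lt_of_lt_of_le ha measureReal_nonneg, fun δ hδ => ?_⟩
  obtain ⟨C', hC'⟩ := hB4 (δ / 4) (by positivity)
  set C := max C' 1
  have hC : 0 < C := lt_max_of_lt_right one_pos
  set ε₂ := δ / 4 * (ε / 4) / (p + 1) with hε₂
  obtain ⟨M, hM, y₁, hXb⟩ := hB1.autoregression_tail_le hXmeas hξmeas hmodel hchar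
    (hstat.measureReal_abs_gt hXmeas) hindep hα htail (show 0 < ε₂ by positivity)
  obtain ⟨D, hD, hinc⟩ := hB1.exists_increment_bound hα hB2 (half_pos hc)
    (show 0 < c / 2 + dd + 3 by linarith)
  set ε' := ε / (96 * D) with hε'
  have hε'0 : 0 < ε' := by positivity
  have hη : 0 < ε' / (p * C * M + 1) := by positivity
  have hlast := ((tendsto_add_one_mul_exp_neg (a := dd / ε') (b := ε / 8)
    (by positivity)).comp hsk).eventually_lt_const (show 0 < δ / 4 by positivity)
  filter_upwards [hC', hlast, hdb.eventually_le_const hη,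
    hB3.eventually_le_const (show 0 < ε / (32 * D) by positivity), hb.eventually hinc,
    hb'.eventually_ge_atTop y₁, hb.eventually_gt_atTop 0, hd.eventually_gt_atTop 0,
    hnk.eventually_gt_atTop 1, hnk'.eventually_gt_atTop 1,
    hsk.eventually_ge_atTop (max 1 (max ε' (2 * ε' / c))), eventually_gt_atTop 0]
    with n hBn hlast hdbn hgn hincn hb'n hbn hdn hn1 hn2 hskn hn0
  set K := Real.sqrt (k n)
  have hK1 : 1 ≤ K := (le_max_left _ _).trans hskn
  have hK0 : 0 < K := one_pos.trans_le hK1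
  have hKε : ε' ≤ K := ((le_max_left _ _).trans (le_max_right _ _)).trans hskn
  have hKc : 2 * ε' / c ≤ K := ((le_max_right _ _).trans (le_max_right _ _)).trans hskn
  have hKK : K * K = k n := Real.mul_self_sqrt (Nat.cast_nonneg _)
  have hn : (0 : ℝ) < n := Nat.cast_pos.2 hn0
  have htb : tailDF ν (b n) ≤ K * K / n := by
    rw [hKK, ← inv_div]
    exact tailDF_quantileB_le hn1
  have htb' : tailDF ν (b' n) ≤ K / n := by
    rw [← inv_div]
    exact tailDF_quantileB_le hn2
  have hg0 : 0 < g (b n) := hB2.2.1 _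
  have he0 : 0 < ε' / K := by positivity
  have he1 : ε' / K ≤ 1 := (div_le_one hK0).2 hKε
  have hec : ε' / K ≤ c / 2 := by
    rw [div_le_iff₀ hc] at hKc
    rw [div_le_iff₀ hK0]
    linarith
  set t := K * ε / 4 with ht
  set W : ℕ → Set Ω := fun i => ⋃ j : Fin p,
    {ω | M * b' n < |X ((i : ℤ) - ((j : ℕ) + 1)) ω|} with hW
  have hWm : ∀ i, MeasurableSet (W i) := fun i => MeasurableSet.iUnion fun j =>
    measurableSet_lt measurable_const (hXmeas _).abs
  have hWq : ∀ i, (ℙ : Measure Ω).real (W i) ≤ p * (ε₂ * (K / n)) := fun i => by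
    refine (measureReal_iUnion_fintype_le _).trans ?_
    refine (Finset.sum_le_card_nsmul _ _ (ε₂ * (K / n)) fun j _ => ?_).trans (by simp)
    exact (hXb _ _ hb'n).trans (mul_le_mul_of_nonneg_left htb' (by positivity))
  have hcell : ∀ m ≤ ⌊dd / (ε' / K)⌋₊, ∀ i : ℕ, (ℙ : Measure Ω).real
      ((fun ω => |ξ (i : ℤ) ω|) ⁻¹' Ioc ((c / 2 + m * (ε' / K)) * b n)
        ((c / 2 + m * (ε' / K) + 3 * (ε' / K)) * b n)) ≤
      D * (K * K / n) * (3 * (ε' / K) + g (b n)) := by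
    intro m hm i
    have hm1 : (m : ℝ) * (ε' / K) ≤ dd := by
      rw [← le_div_iff₀ he0]
      exact (Nat.le_floor_iff (div_nonneg (hc.trans hcd).le he0.le)).1 hm
    have hm0 : 0 ≤ (m : ℝ) * (ε' / K) := by positivity
    rw [measureReal_preimage_Ioc_eq (hZmeas i) (htail i)
      (mul_le_mul_of_nonneg_right (by linarith) hbn.le)]
    refine (hincn _ ⟨by linarith, by linarith⟩ _ ⟨by linarith, by linarith⟩ (by linarith)).trans ?_
    rw [add_sub_cancel_left]
    exact mul_le_mul_of_nonneg_right (mul_le_mul_of_nonneg_left htb hD.le) (by positivity)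
  have hh : p * (C / d n * (M * b' n)) ≤ ε' / K * b n := by
    rw [le_div_iff₀ (by positivity)] at hdbn
    set u := K * b' n / b n / d n with hu
    have hu' : b' n = u * b n * d n / K := by
      rw [hu]
      field_simp
    have hu0 : 0 ≤ u ∨ u < 0 := le_or_gt 0 u
    have hle : p * C * M * u ≤ ε' := by
      rcases hu0 with h | h
      · linarith
      · have : 0 ≤ p * C * M := by positivity
        exact (mul_nonpos_of_nonneg_of_nonpos this h.le).trans hε'0.le
    calc p * (C / d n * (M * b' n)) = p * C * M * u * (b n / K) := by
          rw [hu']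
          field_simp
      _ ≤ ε' * (b n / K) := mul_le_mul_of_nonneg_right hle (by positivity)
      _ = ε' / K * b n := by ring
  have hclose : ∀ ω ∉ {ω | C' < |d n * ‖(fun j => φhat n ω j - φc j : Fin p → ℝ)‖|}, ∀ i, ω ∉ W i →
      |Zhat p X (φhat n) i ω - (fun (i : ℕ) ω => |ξ (i : ℤ) ω|) i ω| ≤
        p * (C / d n * (M * b' n)) := by
    intro ω hω i hi
    simp only [hW, mem_iUnion, not_exists, mem_ofPred_eq, not_lt] at hi hω
    refine abs_Zhat_sub_le hmodel ?_ hi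
    rw [le_div_iff₀ hdn, mul_comm]
    exact (le_abs_self _).trans (hω.trans (le_max_left _ _))
  have hmain := measureReal_iSup_sum_gt_le (Z' := fun i => Zhat p X (φhat n) i) hZmeas hZind hWm
    hcd.le he0 hec hbn hh hclose hWq hcell (Finset.Icc 1 n) (show 0 < t by positivity)
  rw [Nat.card_Icc, Nat.add_sub_cancel] at hmain
  have hmarkov : n * (p * (ε₂ * (K / n))) / t ≤ δ / 4 := by
    have : n * (p * (ε₂ * (K / n))) / t = δ / 4 * (p / (p + 1)) := by
      rw [ht, hε₂]
      field_simp
    rw [this]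
    exact mul_le_of_le_one_right (by positivity) ((div_le_one (by positivity)).2 (by linarith))
  have hchern : 2 * (n * (D * (K * K / n) * (3 * (ε' / K) + g (b n)))) - t ≤ -(ε / 8) * K := by
    have h1 : n * (D * (K * K / n) * (3 * (ε' / K) + g (b n))) =
        K * (3 * (D * ε') + D * (K * g (b n))) := by
      field_simp
    have h2 : D * ε' = ε / 96 := by
      rw [hε']
      field_simp
    have h3 : D * (K * g (b n)) ≤ ε / 32 := by
      calc D * (K * g (b n)) ≤ D * (ε / (32 * D)) := mul_le_mul_of_nonneg_left hgn hD.le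
        _ = ε / 32 := by field_simp
    rw [h1, h2, ht]
    linarith [mul_le_mul_of_nonneg_left h3 hK0.le]
  have hdd : dd / (ε' / K) = dd / ε' * K := by
    field_simp
  have hcells : (dd / (ε' / K) + 1) *
      Real.exp (2 * (n * (D * (K * K / n) * (3 * (ε' / K) + g (b n)))) - t) < δ / 4 := by
    rw [hdd]
    refine lt_of_le_of_lt (mul_le_mul_of_nonneg_left (Real.exp_le_exp.2 hchern) ?_) hlast
    have := hc.trans hcd
    positivity
  refine lt_of_le_of_lt (measureReal_mono fun ω hω => ?_) (lt_of_le_of_lt hmain ?_)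
  · simp only [Pi.zero_apply, sub_zero, mem_ofPred_eq] at hω ⊢
    rw [Real.norm_of_nonneg (mul_nonneg (inv_nonneg.2 hK0.le) (Real.iSup_nonneg fun x =>
      Finset.sum_nonneg fun i _ => abs_nonneg _)), inv_mul_eq_div, le_div_iff₀ hK0] at hω
    refine lt_of_lt_of_le ?_ hω
    rw [ht]
    linarith [mul_pos hK0 hε]
  · have : (ℙ : Measure Ω).real
        {ω | C' < |d n * ‖(fun j => φhat n ω j - φc j : Fin p → ℝ)‖|} < δ / 4 := hBn
    linarith

end TailCusum
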